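/- arXiv:1705.06749 — 2 statements merged into one kernel-verified Lean document; each statement's English description precedes it below -/
import Mathlib

section
/- Let A, B, C be finite-dimensional complex Hilbert spaces, let ρ_ABC be a density operator on A⊗B⊗C with marginal ρ_AB, and let R_{B→BC} be a trace-preserving completely positive map from operators on B to operators on B⊗C, with marginal channel R_{B→B} := Tr_C ∘ R_{B→BC}. Then D(ρ_ABC ‖ (id_A⊗R_{B→BC})(ρ_AB)) + Λ_max(ρ_AB ‖ R_{B→B}) ≥ I(A:C|B)_ρ. -/
open scoped ComplexOrder

noncomputable section

namespace QIT

variable {n : Type*} [Fintype n] [DecidableEq n]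

/-- `x ↦ x·log₂ x` with the convention `0·log 0 = 0`. -/
def xlog (x : ℝ) : ℝ := if x = 0 then 0 else x * Real.logb 2 x

/-- Von Neumann entropy (base 2) of a matrix, via its eigenvalues. -/
def vN (ρ : Matrix n n ℂ) : ℝ :=
  if h : ρ.IsHermitian then -∑ i, xlog (h.eigenvalues i) else 0

/-- Matrix logarithm (base 2) via functional calculus on the support. -/
def matLog (ρ : Matrix n n ℂ) : Matrix n n ℂ :=
  if h : ρ.IsHermitian then
    (h.eigenvectorUnitary : Matrix n n ℂ) *
      Matrix.diagonal (fun i =>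
        ((if h.eigenvalues i = 0 then 0 else Real.logb 2 (h.eigenvalues i) : ℝ) : ℂ)) *
      (star (h.eigenvectorUnitary : Matrix n n ℂ))
  else 0

/-- Support inclusion: `supp ρ ⊆ supp σ` (for PSD matrices: `ker σ ⊆ ker ρ`). -/
def suppLe (ρ σ : Matrix n n ℂ) : Prop := ∀ v, σ.mulVec v = 0 → ρ.mulVec v = 0

open Classical in
/-- Umegaki relative entropy (base 2), `+∞` if the support condition fails. -/
def relEnt (ρ σ : Matrix n n ℂ) : EReal :=
  if suppLe ρ σ then (((ρ * (QIT.matLog ρ - QIT.matLog σ)).trace.re : ℝ) : EReal) else ⊤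

/-- Max-relative entropy `D_max(ρ‖σ) = inf{λ : ρ ≤ 2^λ σ}`, `+∞` if no such λ. -/
def dMax (ρ σ : Matrix n n ℂ) : EReal :=
  sInf {x : EReal | ∃ l : ℝ, x = (l : EReal) ∧ ((2 : ℝ) ^ l • σ - ρ).PosSemidef}

/-- Partial trace over the first tensor factor. -/
def ptrFst {α β : Type*} [Fintype α] (M : Matrix (α × β) (α × β) ℂ) : Matrix β β ℂ :=
  Matrix.of fun x y => ∑ i, M (i, x) (i, y)

/-- Partial trace over the second tensor factor. -/
def ptrSnd {α β : Type*} [Fintype β] (M : Matrix (α × β) (α × β) ℂ) : Matrix α α ℂ :=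
  Matrix.of fun x y => ∑ k, M (x, k) (y, k)

/-- Partial trace over the third factor of a tripartite system. -/
def ptrC3 {α β γ : Type*} [Fintype γ] (M : Matrix (α × β × γ) (α × β × γ) ℂ) :
    Matrix (α × β) (α × β) ℂ :=
  Matrix.of fun x y => ∑ k, M (x.1, x.2, k) (y.1, y.2, k)

/-- Conditional mutual information `I(A:C|B) = H(AB) + H(BC) - H(B) - H(ABC)`. -/
def cmi {α β γ : Type*} [Fintype α] [Fintype β] [Fintype γ]
    [DecidableEq α] [DecidableEq β] [DecidableEq γ]
    (ρ : Matrix (α × β × γ) (α × β × γ) ℂ) : ℝ :=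
  vN (ptrC3 ρ) + vN (ptrFst ρ) - vN (ptrSnd (ptrFst ρ)) - vN ρ

/-- Tensoring a map on the second factor with the identity on the first factor. -/
def tensorId {k b b' : Type*} (Φ : Matrix b b ℂ → Matrix b' b' ℂ)
    (M : Matrix (k × b) (k × b) ℂ) : Matrix (k × b') (k × b') ℂ :=
  Matrix.of fun x y => Φ (Matrix.of fun u v => M (x.1, u) (y.1, v)) x.2 y.2

/-- A quantum channel: linear, trace preserving and completely positive. -/
def IsCPTP {b b' : Type*} [Fintype b] [Fintype b']
    (Φ : Matrix b b ℂ →ₗ[ℂ] Matrix b' b' ℂ) : Prop :=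
  (∀ M, (Φ M).trace = M.trace) ∧
    ∀ (k : ℕ) (M : Matrix (Fin k × b) (Fin k × b) ℂ), M.PosSemidef →
      (tensorId (⇑Φ) M).PosSemidef

/-- `Λ_max(ρ_AB‖E)`: max-relative entropy distance from `ρ_AB` to the states
invariant under `id_A ⊗ E`. -/
def lambdaMax {a b : Type*} [Fintype a] [Fintype b]
    (ρ : Matrix (a × b) (a × b) ℂ) (E : Matrix b b ℂ → Matrix b b ℂ) : EReal :=
  ⨅ τ ∈ {τ : Matrix (a × b) (a × b) ℂ |
      τ.PosSemidef ∧ τ.trace = 1 ∧ tensorId E τ = τ}, dMax ρ τ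

end QIT
open scoped ComplexOrder Matrix Kronecker Topology

namespace QIT
set_option linter.unusedSectionVars false
section diag
variable {n m : Type*} [Fintype n] [DecidableEq n] [Fintype m] [DecidableEq m]

/-- diagonal matrix with real entries -/
def rdiag (p : n → ℝ) : Matrix n n ℂ := Matrix.diagonal (fun i => (p i : ℂ))

/-- `ρ = U diag(p) U^H` with `U` unitary. -/
structure IsDiag (ρ U : Matrix n n ℂ) (p : n → ℝ) : Prop where
  left : Uᴴ * U = 1
  right : U * Uᴴ = 1
  eq : ρ = U * rdiag p * Uᴴ

lemma IsDiag.of_herm {ρ : Matrix n n ℂ} (h : ρ.IsHermitian) :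
    IsDiag ρ (h.eigenvectorUnitary : Matrix n n ℂ) h.eigenvalues := by
  refine ⟨?_, ?_, ?_⟩
  · exact Unitary.coe_star_mul_self h.eigenvectorUnitary
  · exact Unitary.coe_mul_star_self h.eigenvectorUnitary
  · have := h.spectral_theorem
    rw [Unitary.conjStarAlgAut_apply] at this
    exact this

lemma exists_diag {ρ : Matrix n n ℂ} (h : ρ.PosSemidef) :
    ∃ U p, IsDiag ρ U p ∧ ∀ i, 0 ≤ p i :=
  ⟨_, _, IsDiag.of_herm h.1, h.eigenvalues_nonneg⟩

lemma diag_intertwine {ρ U V : Matrix n n ℂ} {p q : n → ℝ} (h1 : IsDiag ρ U p)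
    (h2 : IsDiag ρ V q) (g : ℝ → ℝ) :
    U * rdiag (fun i => g (p i)) * Uᴴ = V * rdiag (fun i => g (q i)) * Vᴴ := by
  have h3 : (Vᴴ * U) * rdiag p = rdiag q * (Vᴴ * U) := by
    have e : U * rdiag p * Uᴴ = V * rdiag q * Vᴴ := by rw [← h1.eq, ← h2.eq]
    calc (Vᴴ * U) * rdiag p = Vᴴ * (U * rdiag p * (Uᴴ * U)) := by
            rw [h1.left]; simp [Matrix.mul_assoc]
      _ = Vᴴ * (U * rdiag p * Uᴴ) * U := by simp only [Matrix.mul_assoc]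
      _ = (Vᴴ * V) * rdiag q * Vᴴ * U := by rw [e]; simp only [Matrix.mul_assoc]
      _ = _ := by rw [h2.left]; simp [Matrix.mul_assoc]
  have h4 : (Vᴴ * U) * rdiag (fun i => g (p i)) = rdiag (fun i => g (q i)) * (Vᴴ * U) := by
    ext i j
    have := congrFun (congrFun h3 i) j
    simp only [rdiag, Matrix.mul_diagonal, Matrix.diagonal_mul] at this ⊢
    by_cases hz : (Vᴴ * U) i j = 0
    · simp [hz]
    · rw [mul_comm] at this
      have := mul_right_cancel₀ hz this
      rw [mul_comm]
      have h : p j = q i := by exact_mod_cast this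
      rw [h]
  calc U * rdiag (fun i => g (p i)) * Uᴴ
      = (V * Vᴴ) * U * rdiag (fun i => g (p i)) * Uᴴ := by rw [h2.right]; simp
    _ = V * ((Vᴴ * U) * rdiag (fun i => g (p i))) * Uᴴ := by simp only [Matrix.mul_assoc]
    _ = V * rdiag (fun i => g (q i)) * Vᴴ * (U * Uᴴ) := by
        rw [h4]; simp only [Matrix.mul_assoc]
    _ = _ := by rw [h1.right]; simp

lemma IsDiag.herm {ρ U : Matrix n n ℂ} {p : n → ℝ} (h : IsDiag ρ U p) : ρ.IsHermitian := by
  rw [h.eq, Matrix.IsHermitian]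
  have : (rdiag p)ᴴ = rdiag p := by
    simp only [rdiag, Matrix.diagonal_conjTranspose]
    congr 1; ext i; simp
  simp [Matrix.conjTranspose_mul, this, Matrix.mul_assoc]

lemma IsDiag.matLog {ρ U : Matrix n n ℂ} {p : n → ℝ} (h : IsDiag ρ U p) :
    matLog ρ = U * rdiag (fun i => Real.logb 2 (p i)) * Uᴴ := by
  rw [QIT.matLog, dif_pos h.herm, diag_intertwine h (IsDiag.of_herm h.herm) (Real.logb 2)]
  have : ∀ x : ℝ, (if x = 0 then 0 else Real.logb 2 x) = Real.logb 2 x := by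
    intro x; split_ifs with hx <;> simp [*]
  simp only [this]
  rfl

lemma IsDiag.trace {ρ U : Matrix n n ℂ} {p : n → ℝ} (h : IsDiag ρ U p) :
    ρ.trace.re = ∑ i, p i := by
  rw [h.eq, Matrix.trace_mul_comm, ← Matrix.mul_assoc, h.left]
  simp [rdiag, Matrix.trace_diagonal]

/-- relative entropy, real version -/
def Dn (ρ σ : Matrix n n ℂ) : ℝ := (ρ * (matLog ρ - matLog σ)).trace.re

lemma trace_two_diag {U V : Matrix n n ℂ} {a b : n → ℝ} :
    ((U * rdiag a * Uᴴ) * (V * rdiag b * Vᴴ)).trace.re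
      = ∑ i, ∑ j, Complex.normSq ((Uᴴ * V) i j) * (a i * b j) := by
  have : ((U * rdiag a * Uᴴ) * (V * rdiag b * Vᴴ)).trace
     = (rdiag a * (Uᴴ * V) * (rdiag b * (Uᴴ * V)ᴴ)).trace := by
    rw [Matrix.conjTranspose_mul, Matrix.conjTranspose_conjTranspose]
    rw [show (U * rdiag a * Uᴴ) * (V * rdiag b * Vᴴ) = U * (rdiag a * (Uᴴ * V) * (rdiag b * Vᴴ)) by
      simp only [Matrix.mul_assoc], Matrix.trace_mul_comm]
    simp only [Matrix.mul_assoc]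
  rw [this, Matrix.trace]
  rw [Complex.re_sum]
  refine Finset.sum_congr rfl fun i _ => ?_
  rw [Matrix.diag_apply, Matrix.mul_apply, Complex.re_sum]
  refine Finset.sum_congr rfl fun j _ => ?_
  simp only [rdiag, Matrix.diagonal_mul, Matrix.conjTranspose_apply]
  generalize (Uᴴ * V) i j = w
  simp [Complex.normSq_apply]
  ring

lemma IsDiag.trace_log {ρ U : Matrix n n ℂ} {p : n → ℝ} (h1 : IsDiag ρ U p) :
    (ρ * QIT.matLog ρ).trace.re = ∑ i, p i * Real.logb 2 (p i) := by
  rw [h1.matLog]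
  conv_lhs => rw [h1.eq]
  rw [trace_two_diag, h1.left]
  refine Finset.sum_congr rfl fun i _ => ?_
  rw [Finset.sum_eq_single i]
  · simp
  · intro j _ hj; simp [Matrix.one_apply_ne hj.symm]
  · simp

lemma vN_eq {ρ : Matrix n n ℂ} (h : ρ.IsHermitian) : vN ρ = -(ρ * matLog ρ).trace.re := by
  rw [vN, dif_pos h, (IsDiag.of_herm h).trace_log]
  congr 1
  apply Finset.sum_congr rfl
  intro i _
  rw [xlog]
  split_ifs with h0 <;> simp [h0]

lemma row_sum {ρ σ U V : Matrix n n ℂ} {p q : n → ℝ} (h1 : IsDiag ρ U p) (h2 : IsDiag σ V q) (i : n) :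
    ∑ j, Complex.normSq ((Uᴴ * V) i j) = 1 := by
  have : (Uᴴ * V) * (Uᴴ * V)ᴴ = 1 := by
    rw [Matrix.conjTranspose_mul, Matrix.conjTranspose_conjTranspose]
    calc _ = Uᴴ * (V * Vᴴ) * U := by simp only [Matrix.mul_assoc]
      _ = 1 := by rw [h2.right]; simp [h1.left]
  have := congrArg Complex.re (congrFun (congrFun this i) i)
  rw [Matrix.mul_apply] at this
  simp only [Matrix.conjTranspose_apply, Complex.re_sum, Matrix.one_apply_eq, Complex.one_re] at this
  rw [← this]
  refine Finset.sum_congr rfl fun j _ => ?_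
  simp [Complex.normSq_apply]

lemma Dn_eq {ρ σ U V : Matrix n n ℂ} {p q : n → ℝ} (h1 : IsDiag ρ U p) (h2 : IsDiag σ V q) :
    Dn ρ σ = ∑ i, ∑ j, Complex.normSq ((Uᴴ * V) i j) *
      (p i * (Real.logb 2 (p i) - Real.logb 2 (q j))) := by
  rw [Dn, Matrix.mul_sub, Matrix.trace_sub, Complex.sub_re]
  have e1 : (ρ * matLog ρ).trace.re = ∑ i, p i * Real.logb 2 (p i) := by
    rw [h1.matLog]
    conv_lhs => rw [h1.eq]
    rw [trace_two_diag, h1.left]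
    refine Finset.sum_congr rfl fun i _ => ?_
    rw [Finset.sum_eq_single i]
    · simp
    · intro j _ hj; simp [Matrix.one_apply_ne hj.symm]
    · simp
  have e2 : (ρ * matLog σ).trace.re = ∑ i, ∑ j, Complex.normSq ((Uᴴ * V) i j) *
      (p i * Real.logb 2 (q j)) := by
    rw [h2.matLog]
    conv_lhs => rw [h1.eq]
    rw [trace_two_diag]
  rw [e1, e2, ← Finset.sum_sub_distrib]
  refine Finset.sum_congr rfl fun i _ => ?_
  rw [← one_mul (p i * _), ← row_sum h1 h2 i, Finset.sum_mul, ← Finset.sum_sub_distrib]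
  refine Finset.sum_congr rfl fun j _ => ?_
  ring

lemma supp_zero {ρ σ U V : Matrix n n ℂ} {p q : n → ℝ} (h1 : IsDiag ρ U p) (h2 : IsDiag σ V q)
    (hs : suppLe ρ σ) (i j : n) (hq : q j = 0) : (Uᴴ * V) i j * p i = 0 := by
  have hV : σ * V = V * rdiag q := by
    rw [h2.eq, Matrix.mul_assoc, h2.left, Matrix.mul_one]
  have hU : Uᴴ * ρ = rdiag p * Uᴴ := by
    rw [h1.eq, ← Matrix.mul_assoc, ← Matrix.mul_assoc, h1.left, Matrix.one_mul]
  have k : σ.mulVec (fun k => V k j) = 0 := by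
    ext k
    have := congrFun (congrFun hV k) j
    rw [Matrix.mul_apply] at this
    simp only [Matrix.mulVec, dotProduct, Pi.zero_apply]
    rw [this]; simp [rdiag, hq]
  have k2 := hs _ k
  have : (Uᴴ * ρ * V) i j = 0 := by
    rw [Matrix.mul_assoc, Matrix.mul_apply]
    refine Finset.sum_eq_zero fun l _ => ?_
    have := congrFun k2 l
    simp only [Matrix.mulVec, dotProduct, Pi.zero_apply] at this
    rw [Matrix.mul_apply, this, mul_zero]
  rw [hU, Matrix.mul_assoc] at this
  simp only [rdiag, Matrix.diagonal_mul] at this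
  rw [mul_comm]; exact this

end diag
section interface
variable {n m : Type*} [Fintype n] [DecidableEq n] [Fintype m] [DecidableEq m]

/-- the quadratic functional whose supremum over `Y` integrates to the relative entropy -/
def J (t : ℝ) (ρ σ Y : Matrix n n ℂ) : ℝ :=
  2 * (ρ * Y).trace.re - (σ * (Y * Yᴴ)).trace.re - t * (ρ * (Yᴴ * Y)).trace.re

/-- explicit value of the supremum -/
def FF (W : Matrix n n ℂ) (p q : n → ℝ) (t : ℝ) : ℝ :=
  ∑ i, ∑ j, Complex.normSq (W i j) * (p i ^ 2 / (q j + t * p i))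

lemma trace_diag_gram (a : n → ℝ) (Z : Matrix n n ℂ) :
    (rdiag a * (Z * Zᴴ)).trace.re = ∑ i, ∑ j, a i * Complex.normSq (Z i j) := by
  rw [Matrix.trace, Complex.re_sum]
  refine Finset.sum_congr rfl fun i _ => ?_
  rw [Matrix.diag_apply, rdiag, Matrix.diagonal_mul, Matrix.mul_apply, Finset.mul_sum, Complex.re_sum]
  refine Finset.sum_congr rfl fun j _ => ?_
  simp [Complex.normSq_apply]

lemma J_eq {ρ σ U V : Matrix n n ℂ} {p q : n → ℝ} (h1 : IsDiag ρ U p) (h2 : IsDiag σ V q)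
    (t : ℝ) (Z : Matrix n n ℂ) :
    J t ρ σ (V * Z * Uᴴ) = ∑ i, ∑ j, (2 * (p i * ((Uᴴ * V) i j * Z j i)).re
      - (q j + t * p i) * Complex.normSq (Z j i)) := by
  have e1 : (ρ * (V * Z * Uᴴ)).trace.re = ∑ i, ∑ j, (p i * ((Uᴴ * V) i j * Z j i)).re := by
    rw [h1.eq, show U * rdiag p * Uᴴ * (V * Z * Uᴴ) = U * ((rdiag p * ((Uᴴ * V) * Z)) * Uᴴ) by
      simp only [Matrix.mul_assoc], Matrix.trace_mul_comm, Matrix.mul_assoc, h1.left, Matrix.mul_one]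
    rw [Matrix.trace, Complex.re_sum]
    refine Finset.sum_congr rfl fun i _ => ?_
    rw [Matrix.diag_apply, rdiag, Matrix.diagonal_mul, Matrix.mul_apply, Finset.mul_sum,
      Complex.re_sum]
  have e2 : (σ * ((V * Z * Uᴴ) * (V * Z * Uᴴ)ᴴ)).trace.re =
      ∑ j, ∑ i, q j * Complex.normSq (Z j i) := by
    rw [← trace_diag_gram, h2.eq]
    congr 1
    simp only [Matrix.conjTranspose_mul, Matrix.conjTranspose_conjTranspose]
    rw [show V * rdiag q * Vᴴ * (V * Z * Uᴴ * (U * (Zᴴ * Vᴴ))) =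
      V * (rdiag q * (Vᴴ * V) * Z * (Uᴴ * U) * Zᴴ * Vᴴ) by simp only [Matrix.mul_assoc],
      Matrix.trace_mul_comm, Matrix.mul_assoc, h2.left, h1.left]
    simp only [Matrix.mul_one, Matrix.mul_assoc]
  have e3 : (ρ * ((V * Z * Uᴴ)ᴴ * (V * Z * Uᴴ))).trace.re =
      ∑ i, ∑ j, p i * Complex.normSq (Z j i) := by
    have : ∀ i j, Complex.normSq (Z j i) = Complex.normSq (Zᴴ i j) := by
      intro i j; simp [Matrix.conjTranspose_apply, Complex.normSq_conj]
    simp only [this]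
    rw [← trace_diag_gram, h1.eq]
    congr 1
    simp only [Matrix.conjTranspose_mul, Matrix.conjTranspose_conjTranspose]
    rw [show U * rdiag p * Uᴴ * (U * (Zᴴ * Vᴴ) * (V * Z * Uᴴ)) =
      U * (rdiag p * (Uᴴ * U) * Zᴴ * (Vᴴ * V) * Z * Uᴴ) by simp only [Matrix.mul_assoc],
      Matrix.trace_mul_comm, Matrix.mul_assoc, h2.left, h1.left]
    simp only [Matrix.mul_one, Matrix.mul_assoc]
  rw [Finset.sum_comm] at e2
  rw [J, e1, e2, e3]
  simp only [Finset.mul_sum, ← Finset.sum_sub_distrib]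
  refine Finset.sum_congr rfl fun i _ => Finset.sum_congr rfl fun j _ => ?_
  ring

lemma term_le (p q t : ℝ) (hp : 0 ≤ p) (hq : 0 ≤ q) (ht : 0 < t) (w z : ℂ) :
    2 * (p * (w * z)).re - (q + t * p) * Complex.normSq z ≤
      Complex.normSq w * (p ^ 2 / (q + t * p)) := by
  by_cases hp0 : p = 0
  · subst hp0
    simp
    exact mul_nonneg hq (Complex.normSq_nonneg _)
  have hd : 0 < q + t * p := by positivity
  rw [← mul_div_assoc, le_div_iff₀ hd]
  simp only [Complex.normSq_apply, Complex.mul_re, Complex.ofReal_re, Complex.ofReal_im, zero_mul,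
    sub_zero, Complex.mul_im]
  nlinarith [sq_nonneg (p * w.re - (q + t * p) * z.re), sq_nonneg (p * w.im + (q + t * p) * z.im)]

lemma term_eq (p q t : ℝ) (hp : 0 ≤ p) (hq : 0 ≤ q) (ht : 0 < t) (w : ℂ) :
    2 * (p * (w * (((p / (q + t * p) : ℝ) : ℂ) * star w))).re - (q + t * p) *
      Complex.normSq (((p / (q + t * p) : ℝ) : ℂ) * star w) =
      Complex.normSq w * (p ^ 2 / (q + t * p)) := by
  by_cases hp0 : p = 0
  · subst hp0; simp
  have hd : q + t * p ≠ 0 := by positivity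
  simp only [Complex.normSq_apply, Complex.mul_re, Complex.ofReal_re, Complex.ofReal_im, zero_mul,
    sub_zero, Complex.mul_im, Complex.star_def, Complex.conj_re, Complex.conj_im]
  field_simp
  ring

lemma J_le_FF {ρ σ U V : Matrix n n ℂ} {p q : n → ℝ} (h1 : IsDiag ρ U p) (h2 : IsDiag σ V q)
    (hp : ∀ i, 0 ≤ p i) (hq : ∀ i, 0 ≤ q i) {t : ℝ} (ht : 0 < t) (Y : Matrix n n ℂ) :
    J t ρ σ Y ≤ FF (Uᴴ * V) p q t := by
  have : Y = V * (Vᴴ * Y * U) * Uᴴ := by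
    rw [show V * (Vᴴ * Y * U) * Uᴴ = (V * Vᴴ) * Y * (U * Uᴴ) by simp only [Matrix.mul_assoc],
      h1.right, h2.right]; simp
  rw [this, J_eq h1 h2]
  exact Finset.sum_le_sum fun i _ => Finset.sum_le_sum fun j _ =>
    term_le _ _ _ (hp i) (hq j) ht _ _

lemma J_eq_FF {ρ σ U V : Matrix n n ℂ} {p q : n → ℝ} (h1 : IsDiag ρ U p) (h2 : IsDiag σ V q)
    (hp : ∀ i, 0 ≤ p i) (hq : ∀ i, 0 ≤ q i) {t : ℝ} (ht : 0 < t) :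
    ∃ Y, J t ρ σ Y = FF (Uᴴ * V) p q t := by
  refine ⟨V * (Matrix.of fun j i => ((p i / (q j + t * p i) : ℝ) : ℂ) * star ((Uᴴ * V) i j)) * Uᴴ, ?_⟩
  rw [J_eq h1 h2]
  exact Finset.sum_congr rfl fun i _ => Finset.sum_congr rfl fun j _ =>
    term_eq _ _ _ (hp i) (hq j) ht _

open intervalIntegral MeasureTheory Filter

lemma term_int (p q T : ℝ) (hp : 0 ≤ p) (hq : 0 < q) (hT : 0 < T) :
    IntervalIntegrable (fun t => p ^ 2 / (q + t * p)) volume 0 T ∧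
    ∫ t in (0:ℝ)..T, p ^ 2 / (q + t * p) = p * (Real.log (q + T * p) - Real.log q) := by
  have hc : ContinuousOn (fun t : ℝ => p ^ 2 / (q + t * p)) (Set.uIcc 0 T) := by
    rw [Set.uIcc_of_le hT.le]
    apply ContinuousOn.div (by fun_prop) (by fun_prop)
    intro t ht
    have := ht.1
    positivity
  refine ⟨hc.intervalIntegrable, ?_⟩
  rw [integral_eq_sub_of_hasDerivAt (f := fun t => p * Real.log (q + t * p)) ?_ hc.intervalIntegrable]
  · simp; ring
  · intro t ht
    rw [Set.uIcc_of_le hT.le] at ht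
    have h0 : 0 < q + t * p := by have := ht.1; positivity
    have h1 : HasDerivAt (fun t : ℝ => q + t * p) p t := by
      simpa using ((hasDerivAt_id t).mul_const p).const_add q
    have := (h1.log h0.ne').const_mul p
    rw [pow_two, mul_div_assoc]
    exact this

lemma term_lim (p q : ℝ) (hp : 0 ≤ p) (hq : 0 < q) :
    Tendsto (fun T : ℝ => p * (Real.log (q + T * p) - Real.log q) - Real.log T * p) atTop
      (𝓝 (p * (Real.log p - Real.log q))) := by
  rcases hp.eq_or_lt with rfl | hp
  · simp
  have h1 : Tendsto (fun T : ℝ => p * (Real.log (q * T⁻¹ + p) - Real.log q)) atTop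
      (𝓝 (p * (Real.log (q * 0 + p) - Real.log q))) := by
    apply Tendsto.const_mul
    apply Tendsto.sub_const
    apply Tendsto.log
    · exact (tendsto_inv_atTop_zero.const_mul q).add_const p
    · simp [hp.ne']
  rw [mul_zero, zero_add] at h1
  refine h1.congr' ?_
  filter_upwards [eventually_gt_atTop 0] with T hT
  have : q + T * p = T * (q * T⁻¹ + p) := by field_simp
  rw [this, Real.log_mul hT.ne' (by positivity)]
  ring

lemma FF_interface {ρ σ U V : Matrix n n ℂ} {p q : n → ℝ} (h1 : IsDiag ρ U p) (h2 : IsDiag σ V q)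
    (hp : ∀ i, 0 ≤ p i) (hq : ∀ i, 0 ≤ q i) (hs : suppLe ρ σ) :
    (∀ T : ℝ, 0 < T → IntervalIntegrable (FF (Uᴴ * V) p q) volume 0 T) ∧
    Tendsto (fun T => (∫ t in (0:ℝ)..T, FF (Uᴴ * V) p q t) - Real.log T * ρ.trace.re) atTop
      (𝓝 (Real.log 2 * Dn ρ σ)) := by
  set W := Uᴴ * V with hW
  have hz : ∀ i j, q j = 0 → Complex.normSq (W i j) = 0 ∨ p i = 0 := by
    intro i j h
    have := supp_zero h1 h2 hs i j h
    rcases mul_eq_zero.1 this with h | h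
    · left; simp [hW, h]
    · right; exact_mod_cast h
  have key : ∀ i j, (∀ T : ℝ, 0 < T →
      IntervalIntegrable (fun t => Complex.normSq (W i j) * (p i ^ 2 / (q j + t * p i))) volume 0 T) ∧
      Tendsto (fun T => (∫ t in (0:ℝ)..T, Complex.normSq (W i j) * (p i ^ 2 / (q j + t * p i)))
        - Real.log T * (Complex.normSq (W i j) * p i)) atTop
       (𝓝 (Complex.normSq (W i j) * (p i * (Real.log (p i) - Real.log (q j))))) := by
    intro i j
    rcases (hq j).eq_or_lt with h0 | h0
    · rcases hz i j h0.symm with h | h <;> simp [h]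
    · refine ⟨fun T hT => (term_int _ _ T (hp i) h0 hT).1.const_mul _, ?_⟩
      refine ((term_lim _ _ (hp i) h0).const_mul (Complex.normSq (W i j))).congr' ?_
      filter_upwards [eventually_gt_atTop 0] with T hT
      rw [intervalIntegral.integral_const_mul, (term_int _ _ T (hp i) h0 hT).2]
      ring
  have hII : ∀ T : ℝ, 0 < T → IntervalIntegrable (FF W p q) volume 0 T := by
    intro T hT
    have : FF W p q = ∑ i, ∑ j, fun t => Complex.normSq (W i j) * (p i ^ 2 / (q j + t * p i)) := by
      ext t; simp [FF, Finset.sum_apply]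
    rw [this]
    exact IntervalIntegrable.sum _ fun i _ => IntervalIntegrable.sum _ fun j _ => (key i j).1 T hT
  refine ⟨hII, ?_⟩
  have hl : Real.log 2 * Dn ρ σ = ∑ i, ∑ j,
      Complex.normSq (W i j) * (p i * (Real.log (p i) - Real.log (q j))) := by
    rw [Dn_eq h1 h2, Finset.mul_sum]
    refine Finset.sum_congr rfl fun i _ => ?_
    rw [Finset.mul_sum]
    refine Finset.sum_congr rfl fun j _ => ?_
    have : Real.log 2 ≠ 0 := (Real.log_pos (by norm_num)).ne'
    rw [Real.logb, Real.logb]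
    field_simp
    rw [hW]
    ring
  rw [hl]
  refine (tendsto_finsetSum _ fun i _ => tendsto_finsetSum _ fun j _ => (key i j).2).congr' ?_
  filter_upwards [eventually_gt_atTop 0] with T hT
  simp only [Finset.sum_sub_distrib]
  congr 1
  · unfold FF
    rw [intervalIntegral.integral_finsetSum]
    · refine Finset.sum_congr rfl fun i _ => ?_
      rw [intervalIntegral.integral_finsetSum]
      intro j _
      exact (key i j).1 T hT
    · intro i _
      have := IntervalIntegrable.sum Finset.univ fun j _ => (key i j).1 T hT
      refine this.congr ?_
      intro t _
      simp
  · rw [h1.trace, Finset.mul_sum]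
    refine Finset.sum_congr rfl fun i _ => ?_
    rw [← Finset.mul_sum, ← Finset.sum_mul, row_sum h1 h2, one_mul]

/-- The interface: relative entropy as a limit of integrals of suprema of linear functionals. -/
lemma interface {ρ σ : Matrix n n ℂ} (hρ : ρ.PosSemidef) (hσ : σ.PosSemidef) (hs : suppLe ρ σ) :
    ∃ F : ℝ → ℝ, (∀ t, 0 < t → IsGreatest (Set.range (J t ρ σ)) (F t)) ∧
      (∀ T : ℝ, 0 < T → IntervalIntegrable F volume 0 T) ∧
      Tendsto (fun T => (∫ t in (0:ℝ)..T, F t) - Real.log T * ρ.trace.re) atTop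
        (𝓝 (Real.log 2 * Dn ρ σ)) := by
  obtain ⟨U, p, h1, hp⟩ := exists_diag hρ
  obtain ⟨V, q, h2, hq⟩ := exists_diag hσ
  refine ⟨FF (Uᴴ * V) p q, fun t ht => ⟨J_eq_FF h1 h2 hp hq ht, ?_⟩, FF_interface h1 h2 hp hq hs⟩
  rintro _ ⟨Y, rfl⟩
  exact J_le_FF h1 h2 hp hq ht Y

/-- Comparison of relative entropies from comparison of the quadratic functionals. -/
lemma Dn_le {ρ σ : Matrix n n ℂ} {ρ' σ' : Matrix m m ℂ}
    (hρ : ρ.PosSemidef) (hσ : σ.PosSemidef) (hs : suppLe ρ σ)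
    (hρ' : ρ'.PosSemidef) (hσ' : σ'.PosSemidef) (hs' : suppLe ρ' σ')
    (htr : ρ'.trace.re = ρ.trace.re)
    (hJ : ∀ t, 0 < t → ∀ Y, ∃ Z, J t ρ' σ' Y ≤ J t ρ σ Z) : Dn ρ' σ' ≤ Dn ρ σ := by
  obtain ⟨F, hF, hi, hl⟩ := interface hρ hσ hs
  obtain ⟨F', hF', hi', hl'⟩ := interface hρ' hσ' hs'
  have : Real.log 2 * Dn ρ' σ' ≤ Real.log 2 * Dn ρ σ := by
    refine le_of_tendsto_of_tendsto hl' hl ?_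
    filter_upwards [eventually_gt_atTop 0] with T hT
    rw [htr]
    apply sub_le_sub_right
    refine intervalIntegral.integral_mono_on_of_le_Ioo hT.le (hi' T hT) (hi T hT) ?_
    intro t ht
    obtain ⟨Y, hY⟩ := (hF' t ht.1).1
    obtain ⟨Z, hZ⟩ := hJ t ht.1 Y
    rw [← hY]
    exact hZ.trans ((hF t ht.1).2 ⟨Z, rfl⟩)
  exact le_of_mul_le_mul_left this (Real.log_pos (by norm_num))

/-- Joint convexity. -/
lemma Dn_convex {ρ₁ σ₁ ρ₂ σ₂ : Matrix n n ℂ} {a b : ℝ} (ha : 0 ≤ a) (hb : 0 ≤ b)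
    (hρ₁ : ρ₁.PosSemidef) (hσ₁ : σ₁.PosSemidef) (hs₁ : suppLe ρ₁ σ₁)
    (hρ₂ : ρ₂.PosSemidef) (hσ₂ : σ₂.PosSemidef) (hs₂ : suppLe ρ₂ σ₂)
    (hs : suppLe (a • ρ₁ + b • ρ₂) (a • σ₁ + b • σ₂)) :
    Dn (a • ρ₁ + b • ρ₂) (a • σ₁ + b • σ₂) ≤ a * Dn ρ₁ σ₁ + b * Dn ρ₂ σ₂ := by
  obtain ⟨F₁, hF₁, hi₁, hl₁⟩ := interface hρ₁ hσ₁ hs₁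
  obtain ⟨F₂, hF₂, hi₂, hl₂⟩ := interface hρ₂ hσ₂ hs₂
  obtain ⟨F, hF, hi, hl⟩ := interface ((hρ₁.smul ha).add (hρ₂.smul hb))
    ((hσ₁.smul ha).add (hσ₂.smul hb)) hs
  have : Real.log 2 * Dn (a • ρ₁ + b • ρ₂) (a • σ₁ + b • σ₂) ≤
      a * (Real.log 2 * Dn ρ₁ σ₁) + b * (Real.log 2 * Dn ρ₂ σ₂) := by
    refine le_of_tendsto_of_tendsto hl ((hl₁.const_mul a).add (hl₂.const_mul b)) ?_
    filter_upwards [eventually_gt_atTop 0] with T hT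
    have e : (a • ρ₁ + b • ρ₂).trace.re = a * ρ₁.trace.re + b * ρ₂.trace.re := by
      simp [Matrix.trace_add, Matrix.trace_smul]
    have : ∫ t in (0:ℝ)..T, F t ≤ ∫ t in (0:ℝ)..T, (a * F₁ t + b * F₂ t) := by
      refine intervalIntegral.integral_mono_on_of_le_Ioo hT.le (hi T hT)
        (((hi₁ T hT).const_mul a).add ((hi₂ T hT).const_mul b)) ?_
      intro t ht
      obtain ⟨Y, hY⟩ := (hF t ht.1).1
      have e : J t (a • ρ₁ + b • ρ₂) (a • σ₁ + b • σ₂) Y = a * J t ρ₁ σ₁ Y + b * J t ρ₂ σ₂ Y := by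
        simp [J, Matrix.add_mul, Matrix.trace_add, Matrix.trace_smul]
        ring
      rw [← hY, e]
      exact add_le_add (mul_le_mul_of_nonneg_left ((hF₁ t ht.1).2 ⟨Y, rfl⟩) ha)
        (mul_le_mul_of_nonneg_left ((hF₂ t ht.1).2 ⟨Y, rfl⟩) hb)
    rw [intervalIntegral.integral_add ((hi₁ T hT).const_mul a) ((hi₂ T hT).const_mul b),
      intervalIntegral.integral_const_mul, intervalIntegral.integral_const_mul] at this
    rw [e]
    linarith
  have h2 : 0 < Real.log 2 := Real.log_pos (by norm_num)
  refine le_of_mul_le_mul_left ?_ h2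
  linarith

end interface
section dpi
variable {n m κ : Type*} [Fintype n] [DecidableEq n] [Fintype m] [DecidableEq m] [Fintype κ]

/-- map in Kraus form -/
def kmap (K : κ → Matrix m n ℂ) (M : Matrix n n ℂ) : Matrix m m ℂ := ∑ k, K k * M * (K k)ᴴ

lemma kmap_psd (K : κ → Matrix m n ℂ) {M : Matrix n n ℂ} (h : M.PosSemidef) :
    (kmap K M).PosSemidef :=
  Matrix.posSemidef_sum _ fun k _ => h.mul_mul_conjTranspose_same (K k)

/-- adjoint map -/
def kadj (K : κ → Matrix m n ℂ) (Y : Matrix m m ℂ) : Matrix n n ℂ := ∑ k, (K k)ᴴ * Y * K k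

lemma kadj_conj (K : κ → Matrix m n ℂ) (Y : Matrix m m ℂ) : (kadj K Y)ᴴ = kadj K Yᴴ := by
  simp [kadj, Matrix.conjTranspose_sum, Matrix.conjTranspose_mul, Matrix.mul_assoc]

lemma kmap_trace (K : κ → Matrix m n ℂ) (M : Matrix n n ℂ) (Y : Matrix m m ℂ) :
    (kmap K M * Y).trace = (M * kadj K Y).trace := by
  rw [kmap, kadj, Finset.sum_mul, Finset.mul_sum, Matrix.trace_sum, Matrix.trace_sum]
  refine Finset.sum_congr rfl fun k _ => ?_
  rw [Matrix.mul_assoc, Matrix.mul_assoc, Matrix.trace_mul_comm]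
  simp only [Matrix.mul_assoc]

lemma schwarz (K : κ → Matrix m n ℂ) (hK : ∑ k, (K k)ᴴ * K k = 1) (Y : Matrix m m ℂ) :
    (kadj K (Y * Yᴴ) - kadj K Y * (kadj K Y)ᴴ).PosSemidef := by
  set Z := (kadj K Y)ᴴ with hZ
  have hZ' : kadj K Y = Zᴴ := by rw [hZ, Matrix.conjTranspose_conjTranspose]
  have : kadj K (Y * Yᴴ) - kadj K Y * Z =
      ∑ k, (Yᴴ * K k - K k * Z)ᴴ * (Yᴴ * K k - K k * Z) := by
    have e : ∀ k, (Yᴴ * K k - K k * Z)ᴴ * (Yᴴ * K k - K k * Z) =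
      (K k)ᴴ * (Y * Yᴴ) * K k - ((K k)ᴴ * Y * K k) * Z - Zᴴ * ((K k)ᴴ * Yᴴ * K k)
       + Zᴴ * ((K k)ᴴ * K k) * Z := by
      intro k
      simp only [Matrix.conjTranspose_sub, Matrix.conjTranspose_mul, Matrix.conjTranspose_conjTranspose,
        Matrix.sub_mul, Matrix.mul_sub, Matrix.mul_assoc]
      abel
    simp only [e, Finset.sum_add_distrib, Finset.sum_sub_distrib]
    rw [← Finset.sum_mul, ← Finset.sum_mul, ← Finset.mul_sum, ← Finset.mul_sum, hK]
    change _ = kadj K (Y * Yᴴ) - kadj K Y * Z - Zᴴ * kadj K Yᴴ + _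
    rw [← kadj_conj, ← hZ, hZ']
    simp
  rw [this]
  exact Matrix.posSemidef_sum _ fun k _ => Matrix.posSemidef_conjTranspose_mul_self _

lemma trace_mul_nonneg {P Q : Matrix n n ℂ} (hP : P.PosSemidef) (hQ : Q.PosSemidef) :
    0 ≤ (P * Q).trace.re := by
  obtain ⟨U, p, h1, hp⟩ := exists_diag hP
  obtain ⟨V, q, h2, hq⟩ := exists_diag hQ
  rw [h1.eq, h2.eq, trace_two_diag]
  exact Finset.sum_nonneg fun i _ => Finset.sum_nonneg fun j _ =>
    mul_nonneg (Complex.normSq_nonneg _) (mul_nonneg (hp i) (hq j))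

/-- Data processing. -/
lemma dpi (K : κ → Matrix m n ℂ) (hK : ∑ k, (K k)ᴴ * K k = 1) {ρ σ : Matrix n n ℂ}
    (hρ : ρ.PosSemidef) (hσ : σ.PosSemidef) (hs : suppLe ρ σ)
    (hs' : suppLe (kmap K ρ) (kmap K σ)) : Dn (kmap K ρ) (kmap K σ) ≤ Dn ρ σ := by
  refine Dn_le hρ hσ hs (kmap_psd K hρ) (kmap_psd K hσ) hs' ?_ ?_
  · have := kmap_trace K ρ 1
    have e : kadj K 1 = 1 := by rw [← hK]; simp [kadj]
    rw [e, Matrix.mul_one, Matrix.mul_one] at this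
    rw [this]
  · intro t ht Y
    refine ⟨kadj K Y, ?_⟩
    have h1 := trace_mul_nonneg hσ (schwarz K hK Y)
    have h2 := trace_mul_nonneg hρ (schwarz K hK Yᴴ)
    rw [Matrix.mul_sub, Matrix.trace_sub, Complex.sub_re] at h1 h2
    rw [← kadj_conj, Matrix.conjTranspose_conjTranspose, Matrix.conjTranspose_conjTranspose] at h2
    rw [J, J, kmap_trace, kmap_trace, kmap_trace]
    nlinarith

/-- antitone in the second argument -/
lemma Dn_anti {ρ σ τ : Matrix n n ℂ} (hρ : ρ.PosSemidef) (hσ : σ.PosSemidef) (hs : suppLe ρ σ)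
    (hτ : τ.PosSemidef) (hs' : suppLe ρ τ) (h : (τ - σ).PosSemidef) : Dn ρ τ ≤ Dn ρ σ := by
  refine Dn_le hρ hσ hs hρ hτ hs' rfl fun t ht Y => ⟨Y, ?_⟩
  have h1 := trace_mul_nonneg h (Matrix.posSemidef_self_mul_conjTranspose Y)
  rw [Matrix.sub_mul, Matrix.trace_sub, Complex.sub_re] at h1
  rw [J, J]
  linarith

lemma suppLe_of_le {ρ σ : Matrix n n ℂ} {c : ℝ} (hρ : ρ.PosSemidef)
    (h : (c • σ - ρ).PosSemidef) : suppLe ρ σ := by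
  intro v hv
  rw [← hρ.dotProduct_mulVec_zero_iff]
  have h1 := h.dotProduct_mulVec_nonneg v
  rw [Matrix.sub_mulVec, Matrix.smul_mulVec, hv, smul_zero, zero_sub, dotProduct_neg] at h1
  exact le_antisymm (by simpa using h1) (hρ.dotProduct_mulVec_nonneg v)

lemma rdiag_psd {p : n → ℝ} (hp : ∀ i, 0 ≤ p i) : (rdiag p).PosSemidef := by
  apply Matrix.PosSemidef.diagonal
  intro i
  simpa using hp i

lemma exists_le_of_suppLe {ρ σ : Matrix n n ℂ} (hρ : ρ.PosSemidef) (hσ : σ.PosSemidef)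
    (hs : suppLe ρ σ) : ∃ c : ℝ, 0 ≤ c ∧ (c • σ - ρ).PosSemidef := by
  obtain ⟨U, p, h1, hp⟩ := exists_diag hρ
  obtain ⟨V, q, h2, hq⟩ := exists_diag hσ
  -- ρ ≤ t • 1
  set t := ∑ i, p i
  have ht : ∀ i, p i ≤ t := fun i => Finset.single_le_sum (fun i _ => hp i) (Finset.mem_univ i)
  have ht0 : 0 ≤ t := Finset.sum_nonneg fun i _ => hp i
  set W := Uᴴ * V with hW
  let e : n → ℝ := fun j => if q j = 0 then 0 else 1
  have hpW : rdiag p * W = rdiag p * W * rdiag e := by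
    ext i j
    simp only [rdiag, Matrix.mul_diagonal, Matrix.diagonal_mul]
    by_cases h : q j = 0
    · have := supp_zero h1 h2 hs i j h
      rw [mul_comm] at this
      rw [this]; simp
    · simp [e, h]
  have he : (rdiag e)ᴴ = rdiag e := by
    simp only [rdiag, Matrix.diagonal_conjTranspose]
    congr 1; ext i; simp
  have hpp : (rdiag p)ᴴ = rdiag p := (rdiag_psd hp).1
  have hpW' : Wᴴ * rdiag p = rdiag e * Wᴴ * rdiag p := by
    have := congrArg Matrix.conjTranspose hpW
    simpa [Matrix.conjTranspose_mul, he, hpp, Matrix.mul_assoc] using this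
  have hN : Wᴴ * rdiag p * W = rdiag e * (Wᴴ * rdiag p * W) * rdiag e := by
    calc Wᴴ * rdiag p * W = Wᴴ * (rdiag p * W) := by simp only [Matrix.mul_assoc]
      _ = (Wᴴ * rdiag p) * W * rdiag e := by rw [hpW]; simp only [Matrix.mul_assoc]
      _ = (rdiag e * Wᴴ * rdiag p) * W * rdiag e := by rw [← hpW']
      _ = _ := by simp only [Matrix.mul_assoc]
  obtain ⟨c, hc0, hc⟩ : ∃ c : ℝ, 0 ≤ c ∧ ∀ j, q j ≠ 0 → t ≤ c * q j := by
    refine ⟨∑ j, t / q j, Finset.sum_nonneg fun j _ => div_nonneg ht0 (hq j), fun j hj => ?_⟩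
    have hj' : 0 < q j := lt_of_le_of_ne (hq j) (Ne.symm hj)
    rw [← div_le_iff₀ hj']
    exact Finset.single_le_sum (f := fun j => t / q j)
      (fun j _ => div_nonneg ht0 (hq j)) (Finset.mem_univ j)
  refine ⟨c, hc0, ?_⟩
  have hWW : Wᴴ * W = 1 := by
    rw [hW, Matrix.conjTranspose_mul, Matrix.conjTranspose_conjTranspose]
    calc _ = Vᴴ * (U * Uᴴ) * V := by simp only [Matrix.mul_assoc]
      _ = 1 := by rw [h1.right]; simp [h2.left]
  have hA : (rdiag (fun j => c * q j - t * e j)).PosSemidef := by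
    apply rdiag_psd
    intro j
    by_cases h : q j = 0
    · simp [e, h]
    · have := hc j h
      simp [e, h]; linarith
  have hB : (rdiag (fun i => t - p i)).PosSemidef := rdiag_psd fun i => sub_nonneg.2 (ht i)
  have hB' := (hB.conjTranspose_mul_mul_same W).conjTranspose_mul_mul_same (rdiag e)
  have hT := (hA.add hB').mul_mul_conjTranspose_same V
  convert hT using 1
  have eB : rdiag (fun i => t - p i) = t • (1 : Matrix n n ℂ) - rdiag p := by
    ext i j
    by_cases h : i = j
    · subst h; simp [rdiag]
    · simp [rdiag, h]
  have eA : rdiag (fun j => c * q j - t * e j) = c • rdiag q - t • rdiag e := by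
    ext i j
    by_cases h : i = j
    · subst h; simp [rdiag]
    · simp [rdiag, h]
  have ee : rdiag e * rdiag e = rdiag e := by
    rw [rdiag, Matrix.diagonal_mul_diagonal]
    congr 1; ext i
    by_cases h : q i = 0 <;> simp [e, h]
  have e5 : (rdiag e)ᴴ * (Wᴴ * rdiag (fun i => t - p i) * W) * rdiag e
      = t • rdiag e - Wᴴ * rdiag p * W := by
    rw [he, eB, hN, Matrix.mul_sub, Matrix.sub_mul, Matrix.mul_sub, Matrix.sub_mul]
    congr 1
    · simp [hWW, ee]
  rw [eA, e5, sub_add_sub_cancel, Matrix.mul_sub, Matrix.sub_mul]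
  congr 1
  · rw [h2.eq]; simp
  · rw [h1.eq, hW, Matrix.conjTranspose_mul, Matrix.conjTranspose_conjTranspose]
    calc _ = (V * Vᴴ) * (U * rdiag p * Uᴴ) * (V * Vᴴ) := by rw [h2.right]; simp
      _ = _ := by simp only [Matrix.mul_assoc]

lemma Dn_scale {ρ σ : Matrix n n ℂ} (hρ : ρ.PosSemidef) (hσ : σ.PosSemidef) (hs : suppLe ρ σ)
    (l : ℝ) : Dn ρ ((2:ℝ) ^ l • σ) = Dn ρ σ - l * ρ.trace.re := by
  obtain ⟨U, p, h1, hp⟩ := exists_diag hρ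
  obtain ⟨V, q, h2, hq⟩ := exists_diag hσ
  have h3 : IsDiag ((2:ℝ) ^ l • σ) V (fun j => (2:ℝ) ^ l * q j) := by
    refine ⟨h2.left, h2.right, ?_⟩
    have : rdiag (fun j => (2:ℝ) ^ l * q j) = (2:ℝ) ^ l • rdiag q := by
      ext i j
      by_cases h : i = j
      · subst h; simp [rdiag]
      · simp [rdiag, h]
    rw [this, h2.eq]; simp
  rw [Dn_eq h1 h2, Dn_eq h1 h3, h1.trace, Finset.mul_sum, ← Finset.sum_sub_distrib]
  refine Finset.sum_congr rfl fun i _ => ?_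
  rw [← one_mul (l * p i), ← row_sum h1 h2 i, Finset.sum_mul, ← Finset.sum_sub_distrib]
  refine Finset.sum_congr rfl fun j _ => ?_
  by_cases h : q j = 0
  · have := supp_zero h1 h2 hs i j h
    rcases mul_eq_zero.1 this with h | h
    · simp [h]
    · have h : p i = 0 := by exact_mod_cast h
      simp [h]
  · rw [Real.logb_mul (by positivity) h, Real.logb_rpow (by norm_num) (by norm_num)]
    ring

/-- chi-square type bound near the reference state -/
lemma Dn_chi {ρ σ : Matrix n n ℂ} (hρ : ρ.PosSemidef) (hσ : σ.PosSemidef)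
    (hs : suppLe ρ σ) (ht : ρ.trace = σ.trace) :
    ∃ K : ℝ, ∀ s : ℝ, 0 ≤ s → ((1 + s) • σ - s • ρ).PosSemidef →
      Dn ((1 + s) • σ - s • ρ) σ ≤ K * s ^ 2 := by
  obtain ⟨V, q, h2, hq⟩ := exists_diag hσ
  set Δ := rdiag q - Vᴴ * ρ * V with hΔ
  have hl2 : 0 < Real.log 2 := Real.log_pos (by norm_num)
  refine ⟨(∑ j, (∑ i, Complex.normSq (Δ i j)) / q j) / Real.log 2, fun s hs0 hpsd => ?_⟩
  set ρ' := (1 + s) • σ - s • ρ with hρ'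
  have hs' : suppLe ρ' σ := by
    refine suppLe_of_le (c := 1 + s) hpsd ?_
    rw [hρ', sub_sub_cancel]
    exact hρ.smul hs0
  obtain ⟨U, p, h1, hp⟩ := exists_diag hpsd
  have htr : ∑ i, p i = ∑ j, q j := by
    rw [← h1.trace, ← h2.trace, hρ', Matrix.trace_sub, Matrix.trace_smul, Matrix.trace_smul, ht]
    simp; ring
  set W := Uᴴ * V with hW
  have step1 : Real.log 2 * Dn ρ' σ ≤
      (∑ i, ∑ j, Complex.normSq (W i j) * (p i ^ 2 / q j)) - ∑ i, p i := by
    rw [Dn_eq h1 h2, Finset.mul_sum, ← Finset.sum_sub_distrib]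
    refine Finset.sum_le_sum fun i _ => ?_
    have ep : p i = ∑ j, Complex.normSq (W i j) * p i := by
      rw [← Finset.sum_mul, hW, row_sum h1 h2 i, one_mul]
    refine le_of_le_of_eq ?_ (congrArg (fun x => (∑ j, Complex.normSq (W i j) * (p i ^ 2 / q j)) - x)
      ep.symm)
    rw [← Finset.sum_sub_distrib, Finset.mul_sum]
    refine Finset.sum_le_sum fun j _ => ?_
    rw [← hW]
    by_cases h : q j = 0
    · have := supp_zero h1 h2 hs' i j h
      rcases mul_eq_zero.1 this with h | h
      · rw [← hW] at h; simp [h]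
      · have h : p i = 0 := by exact_mod_cast h
        simp [h]
    · have hqj : 0 < q j := lt_of_le_of_ne (hq j) (Ne.symm h)
      rcases (hp i).eq_or_lt with h0 | h0
      · simp [← h0]
      have hlog := Real.log_le_sub_one_of_pos (div_pos h0 hqj)
      rw [Real.log_div h0.ne' h] at hlog
      have e : Real.log 2 * (Complex.normSq (W i j) * (p i * (Real.logb 2 (p i) - Real.logb 2 (q j))))
        = Complex.normSq (W i j) * (p i * (Real.log (p i) - Real.log (q j))) := by
        rw [Real.logb, Real.logb]; field_simp
      rw [e, ← mul_sub]
      refine mul_le_mul_of_nonneg_left ?_ (Complex.normSq_nonneg _)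
      calc p i * (Real.log (p i) - Real.log (q j)) ≤ p i * (p i / q j - 1) :=
            mul_le_mul_of_nonneg_left hlog h0.le
        _ = _ := by ring
  have hN : Vᴴ * ρ' * V = rdiag q + s • Δ := by
    have : Vᴴ * σ * V = rdiag q := by
      rw [h2.eq]
      calc _ = (Vᴴ * V) * rdiag q * (Vᴴ * V) := by simp only [Matrix.mul_assoc]
        _ = _ := by rw [h2.left]; simp
    rw [hρ', Matrix.mul_sub, Matrix.sub_mul, Matrix.mul_smul, Matrix.smul_mul, this, hΔ,
      Matrix.mul_smul, Matrix.smul_mul, add_smul, smul_sub, one_smul]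
    abel
  have hrow : ∀ j, ∑ i, Complex.normSq (W i j) * p i ^ 2 =
      ∑ i, Complex.normSq ((rdiag q + s • Δ) i j) := by
    intro j
    have e1 : (Vᴴ * ρ' * V)ᴴ * (Vᴴ * ρ' * V) = (rdiag p * W)ᴴ * (rdiag p * W) := by
      have hh : (rdiag p)ᴴ = rdiag p := (rdiag_psd hp).1
      have : Vᴴ * ρ' * V = Wᴴ * (rdiag p * W) := by
        rw [h1.eq, hW, Matrix.conjTranspose_mul, Matrix.conjTranspose_conjTranspose]
        simp only [Matrix.mul_assoc]
      rw [this, Matrix.conjTranspose_mul, Matrix.conjTranspose_conjTranspose]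
      have hWW : W * Wᴴ = 1 := by
        rw [hW, Matrix.conjTranspose_mul, Matrix.conjTranspose_conjTranspose]
        calc _ = Uᴴ * (V * Vᴴ) * U := by simp only [Matrix.mul_assoc]
          _ = 1 := by rw [h2.right]; simp [h1.left]
      calc _ = (rdiag p * W)ᴴ * (W * Wᴴ) * (rdiag p * W) := by simp only [Matrix.mul_assoc]
        _ = _ := by rw [hWW, Matrix.mul_one]
    rw [hN] at e1
    have e2 := congrArg Complex.re (congrFun (congrFun e1 j) j)
    have gen : ∀ M : Matrix n n ℂ, ((Mᴴ * M) j j).re = ∑ i, Complex.normSq (M i j) := by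
      intro M
      rw [Matrix.mul_apply, Complex.re_sum]
      refine Finset.sum_congr rfl fun i _ => ?_
      simp [Complex.normSq_apply]
    rw [gen, gen] at e2
    rw [e2]
    refine Finset.sum_congr rfl fun i _ => ?_
    rw [rdiag, Matrix.diagonal_mul, Complex.normSq_mul, Complex.normSq_ofReal]
    ring
  have hΔ0 : ∀ j, q j = 0 → (Δ j j).re = 0 := by
    intro j hj
    obtain ⟨U₂, p₂, h3, hp₂⟩ := exists_diag hρ
    have e : Vᴴ * ρ * V = (U₂ᴴ * V)ᴴ * (rdiag p₂ * (U₂ᴴ * V)) := by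
      rw [h3.eq, Matrix.conjTranspose_mul, Matrix.conjTranspose_conjTranspose]
      simp only [Matrix.mul_assoc]
    rw [hΔ, e, Matrix.sub_apply, Matrix.mul_apply]
    have : ∀ i, (rdiag p₂ * (U₂ᴴ * V)) i j = 0 := by
      intro i
      rw [rdiag, Matrix.diagonal_mul, mul_comm]
      exact supp_zero h3 h2 hs i j hj
    simp only [this, mul_zero, Finset.sum_const_zero, sub_zero]
    simp [rdiag, hj]
  have hΔt : ∑ j, (Δ j j).re = 0 := by
    have : Δ.trace = 0 := by
      rw [hΔ, Matrix.trace_sub, Matrix.trace_mul_comm, ← Matrix.mul_assoc, h2.right, Matrix.one_mul,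
        ht, h2.eq, Matrix.trace_mul_comm (V * rdiag q), ← Matrix.mul_assoc, h2.left, Matrix.one_mul,
        sub_self]
    have := congrArg Complex.re this
    rw [Matrix.trace, Complex.re_sum] at this
    simpa using this
  have step2 : ∑ i, ∑ j, Complex.normSq (W i j) * (p i ^ 2 / q j) =
      (∑ j, q j) + s ^ 2 * ∑ j, (∑ i, Complex.normSq (Δ i j)) / q j := by
    rw [Finset.sum_comm]
    have : ∀ j, ∑ i, Complex.normSq (W i j) * (p i ^ 2 / q j) =
        q j + 2 * s * (Δ j j).re + s ^ 2 * ((∑ i, Complex.normSq (Δ i j)) / q j) := by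
      intro j
      have e0 : ∑ i, Complex.normSq (W i j) * (p i ^ 2 / q j) =
          (∑ i, Complex.normSq (W i j) * p i ^ 2) / q j := by
        rw [Finset.sum_div]
        exact Finset.sum_congr rfl fun i _ => by ring
      have e3 : ∑ i, Complex.normSq ((rdiag q + s • Δ) i j) =
          q j ^ 2 + 2 * s * q j * (Δ j j).re + s ^ 2 * ∑ i, Complex.normSq (Δ i j) := by
        have : ∀ i, Complex.normSq ((rdiag q + s • Δ) i j) =
            (if i = j then q j ^ 2 + 2 * s * q j * (Δ j j).re else 0)
              + s ^ 2 * Complex.normSq (Δ i j) := by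
          intro i
          by_cases h : i = j
          · subst h
            simp [rdiag, Complex.normSq_apply]; ring
          · simp [rdiag, Complex.normSq_apply, h]; ring
        simp only [this, Finset.sum_add_distrib, Finset.sum_ite_eq', Finset.mem_univ, if_true,
          Finset.mul_sum]
      rw [e0, hrow j, e3]
      by_cases h : q j = 0
      · simp [h, hΔ0 j h]
      · field_simp
    simp only [this, Finset.sum_add_distrib, ← Finset.mul_sum, hΔt]
    ring
  rw [step2, htr] at step1
  rw [div_mul_eq_mul_div, le_div_iff₀ hl2]
  linarith

end dpi
section tensor
variable {a b c : Type*} [Fintype a] [DecidableEq a] [Fintype b] [DecidableEq b]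
  [Fintype c] [DecidableEq c]

/-- `1 ⊗ X` -/
def tens (a : Type*) [DecidableEq a] (X : Matrix b b ℂ) : Matrix (a × b) (a × b) ℂ :=
  Matrix.of fun x y => if x.1 = y.1 then X x.2 y.2 else 0

lemma tens_mul (X Y : Matrix b b ℂ) : tens a X * tens a Y = tens a (X * Y) := by
  ext ⟨i, x⟩ ⟨j, y⟩
  simp only [tens, Matrix.mul_apply, Matrix.of_apply, Fintype.sum_prod_type]
  by_cases h : i = j
  · subst h
    rw [Finset.sum_eq_single i]
    · simp
    · intro k _ hk; simp [hk.symm]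
    · simp
  · simp only [h, if_false]
    refine Finset.sum_eq_zero fun k _ => Finset.sum_eq_zero fun l _ => ?_
    by_cases h1 : i = k
    · subst h1; simp [h]
    · simp [h1]

lemma tens_conj (X : Matrix b b ℂ) : (tens a X)ᴴ = tens a Xᴴ := by
  ext ⟨i, x⟩ ⟨j, y⟩
  by_cases h : i = j
  · subst h; simp [tens]
  · simp [tens, h, Ne.symm h]

lemma tens_one : tens a (1 : Matrix b b ℂ) = 1 := by
  ext ⟨i, x⟩ ⟨j, y⟩
  simp only [tens, Matrix.of_apply, Matrix.one_apply, Prod.mk.injEq]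
  by_cases h : i = j <;> simp [h]

lemma tens_rdiag (q : b → ℝ) : tens a (rdiag q) = rdiag (fun x : a × b => q x.2) := by
  ext ⟨i, x⟩ ⟨j, y⟩
  simp only [tens, rdiag, Matrix.of_apply, Matrix.diagonal_apply, Prod.mk.injEq]
  by_cases h : i = j <;> simp [h]

lemma tens_add (X Y : Matrix b b ℂ) : tens a (X + Y) = tens a X + tens a Y := by
  ext ⟨i, x⟩ ⟨j, y⟩
  by_cases h : i = j <;> simp [tens, h]

lemma tens_smul (s : ℝ) (X : Matrix b b ℂ) : tens a (s • X) = s • tens a X := by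
  ext ⟨i, x⟩ ⟨j, y⟩
  by_cases h : i = j <;> simp [tens, h]

lemma tens_isDiag {X U : Matrix b b ℂ} {p : b → ℝ} (h : IsDiag X U p) :
    IsDiag (tens a X) (tens a U) (fun x => p x.2) := by
  refine ⟨?_, ?_, ?_⟩
  · rw [tens_conj, tens_mul, h.left, tens_one]
  · rw [tens_conj, tens_mul, h.right, tens_one]
  · rw [tens_conj, ← tens_rdiag, tens_mul, tens_mul, ← h.eq]

lemma tens_psd {X : Matrix b b ℂ} (h : X.PosSemidef) : (tens a X).PosSemidef := by
  obtain ⟨U, p, h1, hp⟩ := exists_diag h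
  have h2 : (rdiag (fun x : a × b => p x.2)).PosSemidef := rdiag_psd fun x => hp x.2
  have h3 := h2.mul_mul_conjTranspose_same (tens a U)
  rw [← (tens_isDiag (a := a) h1).eq] at h3
  exact h3

lemma matLog_tens {X : Matrix b b ℂ} (h : X.PosSemidef) : matLog (tens a X) = tens a (matLog X) := by
  obtain ⟨U, p, h1, hp⟩ := exists_diag h
  rw [(tens_isDiag (a := a) h1).matLog, h1.matLog, ← tens_mul, ← tens_mul, tens_rdiag, tens_conj]

lemma trace_tens (X : Matrix (a × b) (a × b) ℂ) (L : Matrix b b ℂ) :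
    (X * tens a L).trace = (ptrFst X * L).trace := by
  simp only [Matrix.trace, Matrix.diag_apply, Matrix.mul_apply, Fintype.sum_prod_type, tens,
    Matrix.of_apply, ptrFst]
  rw [Finset.sum_comm]
  refine Finset.sum_congr rfl fun x _ => ?_
  simp only [Finset.sum_mul]
  rw [Finset.sum_comm (γ := b)]
  refine Finset.sum_congr rfl fun i _ => ?_
  rw [Finset.sum_eq_single i]
  · simp
  · intro j _ hj; simp [hj]
  · simp

lemma ptrFst_kraus (X : Matrix (a × b) (a × b) ℂ) :
    ptrFst X = kmap (fun i : a => Matrix.of fun (x : b) (y : a × b) => if y = (i, x) then (1:ℂ) else 0) X := by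
  ext x y
  simp [ptrFst, kmap, Matrix.sum_apply, Matrix.mul_apply]

lemma ptrSnd_kraus (X : Matrix (a × b) (a × b) ℂ) :
    ptrSnd X = kmap (fun i : b => Matrix.of fun (x : a) (y : a × b) => if y = (x, i) then (1:ℂ) else 0) X := by
  ext x y
  simp [ptrSnd, kmap, Matrix.sum_apply, Matrix.mul_apply]

/-- Kraus operators of the partial trace over the third factor -/
def KC (a b c : Type*) [DecidableEq a] [DecidableEq b] [DecidableEq c] (k : c) :
    Matrix (a × b) (a × b × c) ℂ :=
  Matrix.of fun x y => if y = (x.1, x.2, k) then (1:ℂ) else 0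

lemma ptrC3_kraus (X : Matrix (a × b × c) (a × b × c) ℂ) :
    ptrC3 X = kmap (KC a b c) X := by
  ext x y
  simp [ptrC3, kmap, KC, Matrix.sum_apply, Matrix.mul_apply]

lemma KC_sum : ∑ k, (KC a b c k)ᴴ * KC a b c k = 1 := by
  ext ⟨i, x, k⟩ ⟨j, y, l⟩
  simp only [Matrix.sum_apply, Matrix.mul_apply, KC, Matrix.conjTranspose_apply, Matrix.of_apply,
    Matrix.one_apply, Fintype.sum_prod_type, Prod.mk.injEq]
  rw [Finset.sum_eq_single k, Finset.sum_eq_single i, Finset.sum_eq_single x]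
  · simp only [and_self, if_true, star_one, one_mul]
    exact if_congr (by constructor <;> rintro ⟨rfl, rfl, rfl⟩ <;> simp) rfl rfl
  · intro y' _ hy; simp [Ne.symm hy]
  · simp
  · intro y' _ hy; simp [Ne.symm hy]
  · simp
  · intro y' _ hy; simp [Ne.symm hy]
  · simp

lemma ptrFst_psd {X : Matrix (a × b) (a × b) ℂ} (h : X.PosSemidef) : (ptrFst X).PosSemidef := by
  rw [ptrFst_kraus]; exact kmap_psd _ h

lemma ptrSnd_psd {X : Matrix (a × b) (a × b) ℂ} (h : X.PosSemidef) : (ptrSnd X).PosSemidef := by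
  rw [ptrSnd_kraus]; exact kmap_psd _ h

lemma ptrC3_psd {X : Matrix (a × b × c) (a × b × c) ℂ} (h : X.PosSemidef) :
    (ptrC3 X).PosSemidef := by
  rw [ptrC3_kraus]; exact kmap_psd _ h

lemma ptr_comm (X : Matrix (a × b × c) (a × b × c) ℂ) :
    ptrSnd (ptrFst X) = ptrFst (ptrC3 X) := by
  ext x y
  simp only [ptrSnd, ptrFst, ptrC3, Matrix.of_apply]
  exact Finset.sum_comm

lemma ptrC3_tens (X : Matrix (b × c) (b × c) ℂ) : ptrC3 (tens a X) = tens a (ptrSnd X) := by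
  ext ⟨i, x⟩ ⟨j, y⟩
  by_cases h : i = j <;> simp [tens, ptrC3, ptrSnd, h]

lemma supp_tens {X : Matrix (a × b) (a × b) ℂ} (h : X.PosSemidef) :
    suppLe X (tens a (ptrFst X)) := by
  intro v hv
  -- embedded vectors
  have h1 : ∀ i j : a, X.mulVec (fun y => if y.1 = j then v (i, y.2) else 0) = 0 := by
    intro i j
    have hB : (ptrFst X).mulVec (fun x => v (i, x)) = 0 := by
      ext x
      have := congrFun hv (i, x)
      simp only [Matrix.mulVec, dotProduct, tens, Matrix.of_apply, Fintype.sum_prod_type] at this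
      rw [Finset.sum_eq_single i] at this
      · simpa [Matrix.mulVec, dotProduct] using this
      · intro k _ hk; simp [Ne.symm hk]
      · simp
    have hsum : ∑ j : a, star (fun y : a × b => if y.1 = j then v (i, y.2) else 0) ⬝ᵥ
        X.mulVec (fun y => if y.1 = j then v (i, y.2) else 0) = 0 := by
      have e : ∑ j : a, star (fun y : a × b => if y.1 = j then v (i, y.2) else 0) ⬝ᵥ
        X.mulVec (fun y => if y.1 = j then v (i, y.2) else 0) =
          star (fun x => v (i, x)) ⬝ᵥ (ptrFst X).mulVec (fun x => v (i, x)) := by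
        simp only [dotProduct, Matrix.mulVec, Fintype.sum_prod_type, ptrFst, Matrix.of_apply,
          Pi.star_apply]
        have : ∀ j : a, ∑ k : a, ∑ x : b, star (if k = j then v (i, x) else 0) *
           ∑ l : a, ∑ y : b, X (k, x) (l, y) * (if l = j then v (i, y) else 0) =
           ∑ x : b, star (v (i, x)) * ∑ y : b, X (j, x) (j, y) * v (i, y) := by
          intro j
          rw [Finset.sum_eq_single j]
          · refine Finset.sum_congr rfl fun x _ => ?_
            rw [if_pos rfl, Finset.sum_eq_single j]
            · simp
            · intro l _ hl; simp [hl]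
            · simp
          · intro l _ hl; simp [hl]
          · simp
        simp only [this]
        rw [Finset.sum_comm]
        refine Finset.sum_congr rfl fun x _ => ?_
        rw [← Finset.mul_sum, Finset.sum_comm]
        simp only [Finset.sum_mul]
      rw [e, hB, dotProduct_zero]
    rw [Finset.sum_eq_zero_iff_of_nonneg (fun j _ => h.dotProduct_mulVec_nonneg _)] at hsum
    exact (h.dotProduct_mulVec_zero_iff _).1 (hsum j (Finset.mem_univ _))
  have h2 : v = ∑ i : a, (fun y : a × b => if y.1 = i then v (i, y.2) else 0) := by
    ext ⟨i, x⟩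
    simp [Finset.sum_apply]
  rw [h2, Matrix.mulVec_sum]
  exact Finset.sum_eq_zero fun i _ => h1 i i

lemma Dn_cond {X : Matrix (a × b) (a × b) ℂ} (h : X.PosSemidef) :
    Dn X (tens a (ptrFst X)) = vN (ptrFst X) - vN X := by
  rw [Dn, matLog_tens (ptrFst_psd h), Matrix.mul_sub, Matrix.trace_sub, trace_tens,
    vN_eq h.1, vN_eq (ptrFst_psd h).1, Complex.sub_re]
  ring

lemma one_isDiag : IsDiag (1 : Matrix b b ℂ) 1 (fun _ => 1) := by
  refine ⟨by simp, by simp, ?_⟩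
  simp [rdiag]

lemma Dn_one {X : Matrix b b ℂ} (h : X.PosSemidef) : Dn X 1 = - vN X := by
  have : matLog (1 : Matrix b b ℂ) = 0 := by
    rw [one_isDiag.matLog]; simp [rdiag]
  rw [Dn, this, sub_zero, vN_eq h.1, neg_neg]

lemma supp_one (X : Matrix b b ℂ) : suppLe X 1 := by
  intro v hv
  rw [Matrix.one_mulVec] at hv
  rw [hv, Matrix.mulVec_zero]

/-- strong subadditivity -/
lemma ssa {X : Matrix (a × b × c) (a × b × c) ℂ} (h : X.PosSemidef) : 0 ≤ cmi X := by
  have hBC := ptrFst_psd h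
  have hk : kmap (KC a b c) (tens a (ptrFst X)) = tens a (ptrFst (ptrC3 X)) := by
    rw [← ptrC3_kraus, ptrC3_tens, ptr_comm]
  have := dpi (KC a b c) KC_sum h (tens_psd hBC) (supp_tens h)
    (by rw [hk, ← ptrC3_kraus]; exact supp_tens (ptrC3_psd h))
  rw [hk, ← ptrC3_kraus, Dn_cond h, Dn_cond (ptrC3_psd h)] at this
  rw [cmi, ptr_comm]
  linarith

end tensor

section channel
variable {a b d : Type*} [Fintype a] [DecidableEq a] [Fintype b] [DecidableEq b]
  [Fintype d] [DecidableEq d]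

lemma exists_kraus (R : Matrix b b ℂ →ₗ[ℂ] Matrix d d ℂ) (hR : IsCPTP R) :
    ∃ (k : ℕ) (K : Fin k × d → Matrix d b ℂ), (∀ M, R M = kmap K M) ∧ ∑ i, (K i)ᴴ * K i = 1 := by
  let k := Fintype.card b
  let e : b ≃ Fin k := Fintype.equivFin b
  let w : Fin k × b → ℂ := fun x => if e x.2 = x.1 then 1 else 0
  have hM : (Matrix.vecMulVec w (star w)).PosSemidef := Matrix.posSemidef_vecMulVec_self_star w
  have hC := hR.2 k _ hM
  obtain ⟨U, p, h1, hp⟩ := exists_diag hC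
  let K : Fin k × d → Matrix d b ℂ := fun z => Matrix.of fun x u => (Real.sqrt (p z) : ℂ) * U (e u, x) z
  have hE : ∀ (u v : b) (x y : d), R (Matrix.single u v 1) x y = ∑ z, K z x u * star (K z y v) := by
    intro u v x y
    have e1 : R (Matrix.single u v 1) x y =
        tensorId (⇑R) (Matrix.vecMulVec w (star w)) (e u, x) (e v, y) := by
      have e0 : Matrix.single u v (1:ℂ) =
          Matrix.of fun u' v' => Matrix.vecMulVec w (star w) (e u, u') (e v, v') := by
        ext u' v'
        simp only [Matrix.single_apply, Matrix.of_apply, Matrix.vecMulVec_apply, w, Pi.star_apply,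
          EmbeddingLike.apply_eq_iff_eq]
        by_cases h1 : u = u' <;> by_cases h2 : v = v' <;>
          simp [h1, h2, eq_comm (a := u') (b := u), eq_comm (a := v') (b := v)]
      rw [e0]
      rfl
    rw [e1, h1.eq, Matrix.mul_apply]
    refine Finset.sum_congr rfl fun z _ => ?_
    have hsq : (p z : ℂ) = (Real.sqrt (p z) : ℂ) * (Real.sqrt (p z) : ℂ) := by
      rw [← Complex.ofReal_mul, Real.mul_self_sqrt (hp z)]
    rw [rdiag, Matrix.mul_diagonal, hsq]
    simp only [K, Matrix.of_apply, Matrix.conjTranspose_apply, star_mul', Complex.star_def,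
      Complex.conj_ofReal]
    ring
  refine ⟨k, K, ?_, ?_⟩
  · intro M
    ext x y
    conv_lhs => rw [Matrix.matrix_eq_sum_single M]
    have e2 : ∀ u v, Matrix.single u v (M u v) = M u v • Matrix.single u v (1:ℂ) := by
      intro u v; simp [Matrix.smul_single]
    simp only [e2, map_sum, map_smul, Matrix.sum_apply, Matrix.smul_apply, hE, kmap,
      Matrix.mul_apply, Matrix.conjTranspose_apply, smul_eq_mul, Finset.mul_sum, Finset.sum_mul]
    rw [Finset.sum_comm]
    conv_lhs => enter [2, v]; rw [Finset.sum_comm]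
    rw [Finset.sum_comm]
    refine Finset.sum_congr rfl fun z _ => Finset.sum_congr rfl fun v _ =>
      Finset.sum_congr rfl fun u _ => ?_
    ring
  · ext v u
    have ht := hR.1 (Matrix.single u v 1)
    simp only [Matrix.trace, Matrix.diag_apply, hE] at ht
    simp only [Matrix.sum_apply, Matrix.mul_apply, Matrix.conjTranspose_apply]
    rw [Finset.sum_comm]
    calc _ = ∑ x, ∑ z, K z x u * star (K z x v) := by
          refine Finset.sum_congr rfl fun x _ => Finset.sum_congr rfl fun z _ => mul_comm _ _
      _ = _ := by
          rw [ht, Matrix.one_apply]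
          by_cases h : u = v
          · subst h; simp [Matrix.single_apply]
          · rw [if_neg (Ne.symm h)]
            refine Finset.sum_eq_zero fun x _ => ?_
            rw [Matrix.single_apply, if_neg]
            rintro ⟨rfl, rfl⟩; exact h rfl

lemma tensorId_kraus {κ : Type*} [Fintype κ] (Φ : Matrix b b ℂ → Matrix d d ℂ) (K : κ → Matrix d b ℂ)
    (hK : ∀ M, Φ M = kmap K M) (M : Matrix (a × b) (a × b) ℂ) :
    tensorId Φ M = kmap (fun k => (1 : Matrix a a ℂ) ⊗ₖ K k) M := by
  ext ⟨i, x⟩ ⟨j, y⟩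
  simp only [tensorId, hK, Matrix.of_apply, kmap, Matrix.sum_apply, Matrix.mul_apply,
    Fintype.sum_prod_type, Matrix.conjTranspose_apply, Matrix.kroneckerMap_apply]
  refine Finset.sum_congr rfl fun k _ => ?_
  symm
  rw [Finset.sum_eq_single j]
  · refine Finset.sum_congr rfl fun v _ => ?_
    rw [Finset.sum_eq_single i]
    · simp
    · intro l _ hl; simp [Ne.symm hl]
    · simp
  · intro l _ hl; simp [Ne.symm hl]
  · simp

lemma tensorId_kraus_sum {κ : Type*} [Fintype κ] (K : κ → Matrix d b ℂ)
    (hK : ∑ k, (K k)ᴴ * K k = 1) :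
    ∑ k, ((1 : Matrix a a ℂ) ⊗ₖ K k)ᴴ * ((1 : Matrix a a ℂ) ⊗ₖ K k) = 1 := by
  have : ∀ k, ((1 : Matrix a a ℂ) ⊗ₖ K k)ᴴ * ((1 : Matrix a a ℂ) ⊗ₖ K k) =
      tens a ((K k)ᴴ * K k) := by
    intro k
    rw [Matrix.conjTranspose_kronecker, ← Matrix.mul_kronecker_mul]
    ext ⟨i, x⟩ ⟨j, y⟩
    by_cases h : i = j <;> simp [tens, h, Matrix.kroneckerMap_apply]
  simp only [this]
  rw [← tens_one, ← hK]
  ext ⟨i, x⟩ ⟨j, y⟩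
  by_cases h : i = j <;> simp [tens, h, Matrix.sum_apply]

lemma tensorId_tens (R : Matrix b b ℂ →ₗ[ℂ] Matrix d d ℂ) (X : Matrix b b ℂ) :
    tensorId (⇑R) (tens a X) = tens a (R X) := by
  ext ⟨i, x⟩ ⟨j, y⟩
  by_cases h : i = j
  · subst h; simp [tensorId, tens]; rfl
  · simp only [tensorId, tens, Matrix.of_apply, h, if_false]
    change R 0 x y = 0
    simp

lemma ptrFst_tensorId (R : Matrix b b ℂ →ₗ[ℂ] Matrix d d ℂ) (X : Matrix (a × b) (a × b) ℂ) :
    ptrFst (tensorId (⇑R) X) = R (ptrFst X) := by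
  have : ptrFst X = ∑ i, Matrix.of fun u v => X (i, u) (i, v) := by
    ext x y; simp [ptrFst, Matrix.sum_apply]
  rw [this, map_sum]
  ext x y
  simp [ptrFst, tensorId, Matrix.sum_apply]

/-- conditional entropy does not decrease under a channel on the conditioning system -/
lemma cond_mono (R : Matrix b b ℂ →ₗ[ℂ] Matrix d d ℂ) (hR : IsCPTP R)
    {X : Matrix (a × b) (a × b) ℂ} (h : X.PosSemidef) :
    (tensorId (⇑R) X).PosSemidef ∧
    vN (ptrFst (tensorId (⇑R) X)) - vN (tensorId (⇑R) X) ≤ vN (ptrFst X) - vN X := by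
  obtain ⟨k, K, hK, hK1⟩ := exists_kraus R hR
  have e := tensorId_kraus (a := a) (⇑R) K hK
  have hp : (tensorId (⇑R) X).PosSemidef := by rw [e]; exact kmap_psd _ h
  refine ⟨hp, ?_⟩
  have e2 : tensorId (⇑R) (tens a (ptrFst X)) = tens a (ptrFst (tensorId (⇑R) X)) := by
    rw [tensorId_tens, ptrFst_tensorId]
  have := dpi _ (tensorId_kraus_sum (a := a) K hK1) h (tens_psd (ptrFst_psd h)) (supp_tens h)
    (by rw [← e, ← e, e2]; exact supp_tens hp)
  rw [← e, ← e, e2, Dn_cond h, Dn_cond hp] at this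
  exact this

end channel
section core
variable {a b c : Type*} [Fintype a] [DecidableEq a] [Fintype b] [DecidableEq b]
  [Fintype c] [DecidableEq c]

lemma ptrC3_lin (α β : ℝ) (X Y : Matrix (a × b × c) (a × b × c) ℂ) :
    ptrC3 (α • X + β • Y) = α • ptrC3 X + β • ptrC3 Y := by
  ext x y
  simp [ptrC3, Finset.sum_add_distrib, Finset.mul_sum]

lemma ptrFst_lin (α β : ℝ) (X Y : Matrix (a × b) (a × b) ℂ) :
    ptrFst (α • X + β • Y) = α • ptrFst X + β • ptrFst Y := by
  ext x y
  simp [ptrFst, Finset.sum_add_distrib, Finset.mul_sum]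

/-- the convex function `D(X‖τ) - I(A:C|B)_X`, written without `H(ABC)` -/
def gg (L X : Matrix (a × b × c) (a × b × c) ℂ) : ℝ :=
  Dn (ptrC3 X) (tens a (ptrFst (ptrC3 X))) + Dn (ptrFst X) 1 - (X * L).trace.re

lemma gg_eq {X : Matrix (a × b × c) (a × b × c) ℂ} (h : X.PosSemidef)
    (τ : Matrix (a × b × c) (a × b × c) ℂ) : gg (matLog τ) X = Dn X τ - cmi X := by
  rw [gg, Dn_cond (ptrC3_psd h), Dn_one (ptrFst_psd h), Dn, Matrix.mul_sub, Matrix.trace_sub,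
    Complex.sub_re, cmi, ptr_comm, vN_eq h.1]
  ring

lemma gg_convex {X Y : Matrix (a × b × c) (a × b × c) ℂ} (hX : X.PosSemidef) (hY : Y.PosSemidef)
    (L : Matrix (a × b × c) (a × b × c) ℂ) {α β : ℝ} (hα : 0 ≤ α) (hβ : 0 ≤ β) (hs : α + β = 1) :
    gg L (α • X + β • Y) ≤ α * gg L X + β * gg L Y := by
  have hXC := ptrC3_psd hX
  have hYC := ptrC3_psd hY
  have e1 : tens a (ptrFst (ptrC3 (α • X + β • Y))) =
      α • tens a (ptrFst (ptrC3 X)) + β • tens a (ptrFst (ptrC3 Y)) := by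
    rw [ptrC3_lin, ptrFst_lin, tens_add, tens_smul, tens_smul]
  have hZ : (α • X + β • Y).PosSemidef := (hX.smul hα).add (hY.smul hβ)
  have hsupp := supp_tens (ptrC3_psd hZ)
  rw [e1, ptrC3_lin] at hsupp
  have k1 := Dn_convex hα hβ hXC (tens_psd (ptrFst_psd hXC)) (supp_tens hXC)
    hYC (tens_psd (ptrFst_psd hYC)) (supp_tens hYC) hsupp
  have e2 : (1 : Matrix (b × c) (b × c) ℂ) = α • 1 + β • 1 := by rw [← add_smul, hs, one_smul]
  have k2 := Dn_convex hα hβ (ptrFst_psd hX) Matrix.PosSemidef.one (supp_one _)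
    (ptrFst_psd hY) Matrix.PosSemidef.one (supp_one _) (by rw [← e2]; exact supp_one _)
  rw [← e2, ← ptrFst_lin] at k2
  rw [← e1, ← ptrC3_lin] at k1
  have k3 : ((α • X + β • Y) * L).trace.re = α * (X * L).trace.re + β * (Y * L).trace.re := by
    simp [Matrix.add_mul, Matrix.trace_add, Matrix.trace_smul]
  rw [gg, gg, gg, k3]
  linarith

lemma core {ρ τ : Matrix (a × b × c) (a × b × c) ℂ} (hρ : ρ.PosSemidef) (hτ : τ.PosSemidef)
    (hs : suppLe ρ τ) (ht : ρ.trace = τ.trace) (hc : cmi τ ≤ 0) : cmi ρ ≤ Dn ρ τ := by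
  obtain ⟨K, hK⟩ := Dn_chi hρ hτ hs ht
  obtain ⟨C, hC0, hC⟩ := exists_le_of_suppLe hρ hτ hs
  have main : ∀ s : ℝ, 0 < s → s * (C + 1) ≤ 1 → -(K * s) ≤ gg (matLog τ) ρ := by
    intro s hs0 hs1
    have hX : ((1 + s) • τ - s • ρ).PosSemidef := by
      have : (1 + s) • τ - s • ρ = s • (C • τ - ρ) + (1 + s - s * C) • τ := by
        module
      rw [this]
      exact (hC.smul hs0.le).add (hτ.smul (by nlinarith))
    have h1 := hK s hs0.le hX
    have h2 := ssa hX
    have h3 := gg_eq hX τ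
    have h4 := gg_eq hτ τ
    have h5 : Dn τ τ = 0 := by simp [Dn]
    have hne : (1 + s) ≠ 0 := by positivity
    have h6 := gg_convex hX hρ (matLog τ) (α := 1 / (1 + s)) (β := s / (1 + s))
      (by positivity) (by positivity) (by field_simp)
    have e : (1 / (1 + s)) • ((1 + s) • τ - s • ρ) + (s / (1 + s)) • ρ = τ := by
      rw [smul_sub, smul_smul, smul_smul, one_div, inv_mul_cancel₀ hne, one_smul,
        div_eq_inv_mul, sub_add_cancel]
    rw [e] at h6
    have h7 : 0 ≤ (1 / (1 + s)) * gg (matLog τ) ((1 + s) • τ - s • ρ) +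
      (s / (1 + s)) * gg (matLog τ) ρ := by linarith
    have h8 : 0 ≤ gg (matLog τ) ((1 + s) • τ - s • ρ) + s * gg (matLog τ) ρ := by
      have := mul_nonneg (by positivity : 0 ≤ 1 + s) h7
      have e3 : (1 + s) * ((1 / (1 + s)) * gg (matLog τ) ((1 + s) • τ - s • ρ) +
        (s / (1 + s)) * gg (matLog τ) ρ) =
          gg (matLog τ) ((1 + s) • τ - s • ρ) + s * gg (matLog τ) ρ := by field_simp
      linarith
    have h9 : 0 ≤ s * (K * s + gg (matLog τ) ρ) := by nlinarith
    have := nonneg_of_mul_nonneg_right h9 hs0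
    linarith
  have hg : 0 ≤ gg (matLog τ) ρ := by
    by_contra hneg
    push Not at hneg
    set g := gg (matLog τ) ρ
    have hK1 : 0 < |K| + 1 := by positivity
    have hC1 : 0 < C + 1 := by positivity
    set s := min (1 / (C + 1)) (-g / (2 * (|K| + 1))) with hsdef
    have hs0 : 0 < s := lt_min (by positivity) (div_pos (by linarith) (by positivity))
    have hs1 : s * (C + 1) ≤ 1 := by
      rw [← le_div_iff₀ hC1]; exact min_le_left _ _
    have hs2 : s * (2 * (|K| + 1)) ≤ -g := by
      rw [← le_div_iff₀ (by positivity)]; exact min_le_right _ _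
    have := main s hs0 hs1
    have hKs : K * s ≤ |K| * s := mul_le_mul_of_nonneg_right (le_abs_self K) hs0.le
    nlinarith [abs_nonneg K, mul_nonneg (abs_nonneg K) hs0.le]
  rw [gg_eq hρ] at hg
  linarith

end core
end QIT

open QIT in
/-- Main result: for any tripartite state `ρ_ABC` and any
trace-preserving completely positive map `R_{B→BC}`,
`D(ρ_ABC ‖ (id_A⊗R)(ρ_AB)) + Λ_max(ρ_AB ‖ R_{B→B}) ≥ I(A:C|B)_ρ`. -/
theorem main_lower_bound {A B C : Type*} [Fintype A] [Fintype B] [Fintype C]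
    [DecidableEq A] [DecidableEq B] [DecidableEq C]
    (ρ : Matrix (A × B × C) (A × B × C) ℂ) (hρ : ρ.PosSemidef) (hρ1 : ρ.trace = 1)
    (R : Matrix B B ℂ →ₗ[ℂ] Matrix (B × C) (B × C) ℂ) (hR : IsCPTP R) :
    relEnt ρ (tensorId (⇑R) (ptrC3 ρ)) + lambdaMax (ptrC3 ρ) (fun M => ptrSnd (R M))
      ≥ ((cmi ρ : ℝ) : EReal) := by

  have htrC : ∀ X : Matrix (A × B × C) (A × B × C) ℂ, (ptrC3 X).trace = X.trace := by
    intro X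
    simp only [Matrix.trace, Matrix.diag_apply, ptrC3, Matrix.of_apply, Fintype.sum_prod_type]
  have hAB := ptrC3_psd hρ
  have hAB1 : (ptrC3 ρ).trace = 1 := by rw [htrC, hρ1]
  have hσ := (cond_mono R hR hAB).1
  obtain ⟨k, K, hK, hK1⟩ := exists_kraus R hR
  have ek := tensorId_kraus (a := A) (⇑R) K hK
  rw [ge_iff_le]
  by_cases hs : suppLe ρ (tensorId (⇑R) (ptrC3 ρ))
  · have hrel : relEnt ρ (tensorId (⇑R) (ptrC3 ρ)) =
        ((Dn ρ (tensorId (⇑R) (ptrC3 ρ)) : ℝ) : EReal) := by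
      rw [relEnt, if_pos hs, Dn]
    have hlam : ((cmi ρ - Dn ρ (tensorId (⇑R) (ptrC3 ρ)) : ℝ) : EReal) ≤
        lambdaMax (ptrC3 ρ) (fun M => ptrSnd (R M)) := by
      rw [lambdaMax]
      refine le_iInf₂ fun τ hτ => ?_
      obtain ⟨hτp, hτ1, hτi⟩ := hτ
      rw [dMax]
      refine le_sInf ?_
      rintro _ ⟨l, rfl, hl⟩
      rw [EReal.coe_le_coe_iff]
      obtain ⟨hTp, hTm⟩ := cond_mono R hR hτp
      set T := tensorId (⇑R) τ with hT
      have hTC : ptrC3 T = τ := hτi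
      have hcmi : cmi T ≤ 0 := by
        rw [cmi, ptr_comm, hTC]
        linarith
      have hle : ((2:ℝ) ^ l • T - tensorId (⇑R) (ptrC3 ρ)).PosSemidef := by
        have := kmap_psd (fun k => (1 : Matrix A A ℂ) ⊗ₖ K k) hl
        rw [← ek] at this
        convert this using 1
        ext ⟨i, x⟩ ⟨j, y⟩
        have e : (Matrix.of fun u v => ((2:ℝ) ^ l • τ - ptrC3 ρ) (i, u) (j, v)) =
          (((2:ℝ) ^ l : ℝ) : ℂ) • (Matrix.of fun u v => τ (i, u) (j, v)) -
            Matrix.of fun u v => ptrC3 ρ (i, u) (j, v) := by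
          ext u v
          simp
        simp only [hT, tensorId, Matrix.sub_apply, Matrix.smul_apply, Matrix.of_apply]
        change _ = R (Matrix.of fun u v => ((2:ℝ) ^ l • τ - ptrC3 ρ) (i, u) (j, v)) x y
        rw [e, map_sub, map_smul]
        simp
      obtain ⟨c, hc0, hc⟩ := exists_le_of_suppLe hρ hσ hs
      have hsT : suppLe ρ T := by
        refine suppLe_of_le (c := c * (2:ℝ) ^ l) hρ ?_
        have e : (c * (2:ℝ) ^ l) • T - ρ = c • ((2:ℝ) ^ l • T - tensorId (⇑R) (ptrC3 ρ)) +
            (c • tensorId (⇑R) (ptrC3 ρ) - ρ) := by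
          rw [smul_sub, smul_smul]; abel
        rw [e]
        exact (hle.smul hc0).add hc
      have h2l : (0:ℝ) ≤ (2:ℝ) ^ l := by positivity
      have hsT' : suppLe ρ ((2:ℝ) ^ l • T) := by
        intro v hv
        apply hsT v
        rw [Matrix.smul_mulVec] at hv
        exact (smul_eq_zero.1 hv).resolve_left (by positivity)
      have hanti := Dn_anti hρ hσ hs (hTp.smul h2l) hsT' hle
      rw [Dn_scale hρ hTp hsT, hρ1, Complex.one_re, mul_one] at hanti
      have hTt : ρ.trace = T.trace := by rw [← htrC T, hTC, hτ1, hρ1]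
      have := core hρ hTp hsT hTt hcmi
      linarith
    rw [hrel]
    calc ((cmi ρ : ℝ) : EReal) = ((Dn ρ (tensorId (⇑R) (ptrC3 ρ)) : ℝ) : EReal) +
          ((cmi ρ - Dn ρ (tensorId (⇑R) (ptrC3 ρ)) : ℝ) : EReal) := by
          rw [← EReal.coe_add]; congr 1; ring
      _ ≤ _ := by gcongr
  · have hrel : relEnt ρ (tensorId (⇑R) (ptrC3 ρ)) = ⊤ := by
      rw [relEnt, if_neg hs]
    have hlam : ((0 : ℝ) : EReal) ≤ lambdaMax (ptrC3 ρ) (fun M => ptrSnd (R M)) := by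
      rw [lambdaMax]
      refine le_iInf₂ fun τ hτ => ?_
      obtain ⟨hτp, hτ1, hτi⟩ := hτ
      rw [dMax]
      refine le_sInf ?_
      rintro _ ⟨l, rfl, hl⟩
      rw [EReal.coe_le_coe_iff]
      have h1 := trace_mul_nonneg hl Matrix.PosSemidef.one
      rw [Matrix.mul_one, Matrix.trace_sub, Matrix.trace_smul, hτ1, hAB1] at h1
      simp at h1
      by_contra hneg
      push Not at hneg
      have := Real.rpow_lt_one_of_one_lt_of_neg (by norm_num : (1:ℝ) < 2) hneg
      linarith
    rw [hrel, EReal.top_add_of_ne_bot]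
    · exact le_top
    · intro h
      rw [h] at hlam
      simp at hlam
end
end

section
/- Let A, B, C be finite-dimensional complex Hilbert spaces and let ρ_ABC be a density operator on A⊗B⊗C. Then for every density operator μ_ABC on A⊗B⊗C that is a Markov chain A↔B↔C (i.e., I(A:C|B)_μ = 0), one has I(A:C|B)_ρ ≤ D(ρ_ABC ‖ μ_ABC). In particular, I(A:C|B)_ρ ≤ inf over Markov chains μ_ABC of D(ρ_ABC ‖ μ_ABC). -/
open scoped ComplexOrder

noncomputable section

namespace QITaux

set_option linter.unusedSectionVars false
set_option linter.unusedSimpArgs false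

open Matrix QIT

/-- A diagonalization of `ρ` by a unitary `U` with real eigenvalues `p`. -/
structure Dg {n m : Type*} [Fintype n] [DecidableEq n] [Fintype m] [DecidableEq m]
    (ρ : Matrix n n ℂ) (U : Matrix n m ℂ) (p : m → ℝ) : Prop where
  uu : Uᴴ * U = 1
  uu' : U * Uᴴ = 1
  eq : ρ = U * Matrix.diagonal (fun i => (p i : ℂ)) * Uᴴ

variable {n m l : Type*} [Fintype n] [DecidableEq n] [Fintype m] [DecidableEq m]
  [Fintype l] [DecidableEq l]

/-- `Re Tr (X log σ)` where `σ = V diag q Vᴴ`. -/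
def Lg (X : Matrix n n ℂ) (V : Matrix n l ℂ) (q : l → ℝ) : ℝ :=
  ∑ j, ((Vᴴ * X * V) j j).re * Real.log (q j)

/-- Overlap weights. -/
def Wt (U : Matrix n m ℂ) (V : Matrix n l ℂ) (i : m) (j : l) : ℝ :=
  Complex.normSq ((Uᴴ * V) i j)

lemma Wt_nonneg (U : Matrix n m ℂ) (V : Matrix n l ℂ) (i : m) (j : l) : 0 ≤ Wt U V i j :=
  Complex.normSq_nonneg _

/-- The variational functional. -/
def Gv (t : ℝ) (ρ σ X : Matrix n n ℂ) : ℝ :=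
  2 * ((Xᴴ * ρ).trace - (Xᴴ * σ).trace).re - ((ρ * (X * Xᴴ)).trace).re
    - t * ((σ * (Xᴴ * X)).trace).re

lemma sum_Wt_left {ρ : Matrix n n ℂ} {U : Matrix n m ℂ} {p : m → ℝ} (h : Dg ρ U p)
    {V : Matrix n l ℂ} (j : l) : ∑ i, Wt U V i j * p i = ((Vᴴ * ρ * V) j j).re := by
  have h1 : Vᴴ * ρ * V = (Uᴴ * V)ᴴ * (Matrix.diagonal (fun i => (p i : ℂ)) * (Uᴴ * V)) := by
    rw [h.eq, conjTranspose_mul, conjTranspose_conjTranspose]; simp only [Matrix.mul_assoc]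
  rw [h1, Matrix.mul_apply, Complex.re_sum]
  refine Finset.sum_congr rfl fun i _ => ?_
  rw [Matrix.diagonal_mul, Matrix.conjTranspose_apply, Wt, Complex.normSq_apply]
  simp only [Complex.star_def, Complex.mul_re, Complex.mul_im, Complex.conj_re, Complex.conj_im,
    Complex.ofReal_re, Complex.ofReal_im]
  ring

lemma dg_one {U : Matrix n m ℂ} (hu : Uᴴ * U = 1) (hu' : U * Uᴴ = 1) :
    Dg (1 : Matrix n n ℂ) U (fun _ => 1) :=
  ⟨hu, hu', by simp [hu']⟩

lemma sum_Wt_one_left {U : Matrix n m ℂ} {V : Matrix n l ℂ} (hu : Uᴴ * U = 1) (hu' : U * Uᴴ = 1)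
    (hv : Vᴴ * V = 1) (j : l) : ∑ i, Wt U V i j = 1 := by
  have := sum_Wt_left (dg_one hu hu') (V := V) j
  simpa [hv] using this

lemma Wt_symm (U : Matrix n m ℂ) (V : Matrix n l ℂ) (i : m) (j : l) : Wt U V i j = Wt V U j i := by
  have : Vᴴ * U = (Uᴴ * V)ᴴ := by simp
  rw [Wt, Wt, this, conjTranspose_apply, Complex.star_def, Complex.normSq_conj]

lemma sum_Wt_one_right {U : Matrix n m ℂ} {V : Matrix n l ℂ} (hu : Uᴴ * U = 1)
    (hv : Vᴴ * V = 1) (hv' : V * Vᴴ = 1) (i : m) : ∑ j, Wt U V i j = 1 := by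
  simp_rw [Wt_symm U V]
  have key := sum_Wt_one_left hv hv' hu i
  simpa only using key

/-- scalar relative entropy -/
def phi (p q : ℝ) : ℝ := p * Real.log p - p * Real.log q - p + q

/-- relative entropy in nats, with trace corrections -/
def Dn (U : Matrix n m ℂ) (p : m → ℝ) (V : Matrix n l ℂ) (q : l → ℝ) : ℝ :=
  ∑ i, ∑ j, Wt U V i j * phi (p i) (q j)

lemma Dn_eq {ρ : Matrix n n ℂ} {U : Matrix n m ℂ} {p : m → ℝ} (h : Dg ρ U p)
    {σ : Matrix n n ℂ} {V : Matrix n l ℂ} {q : l → ℝ} (k : Dg σ V q) :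
    Dn U p V q = (∑ i, p i * Real.log (p i)) - Lg ρ V q - (∑ i, p i) + ∑ j, q j := by
  have h1 : ∀ f : m → ℝ, ∑ i, ∑ j, Wt U V i j * f i = ∑ i, f i := by
    intro f
    refine Finset.sum_congr rfl fun i _ => ?_
    rw [← Finset.sum_mul, sum_Wt_one_right h.uu k.uu k.uu', one_mul]
  have h2 : ∑ i, ∑ j, Wt U V i j * q j = ∑ i, q i := by
    rw [Finset.sum_comm]
    refine Finset.sum_congr rfl fun i _ => ?_
    rw [← Finset.sum_mul, sum_Wt_one_left h.uu h.uu' k.uu, one_mul]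
  have h3 : ∑ i, ∑ j, Wt U V i j * (p i * Real.log (q j)) = Lg ρ V q := by
    rw [Finset.sum_comm, Lg]
    refine Finset.sum_congr rfl fun j _ => ?_
    rw [← sum_Wt_left h, Finset.sum_mul]
    exact Finset.sum_congr rfl fun i _ => by ring
  rw [← h3, ← h2, ← h1 p, ← h1 (fun i => p i * Real.log (p i)), Dn]
  simp only [← Finset.sum_sub_distrib, ← Finset.sum_add_distrib]
  refine Finset.sum_congr rfl fun i _ => Finset.sum_congr rfl fun j _ => ?_
  rw [phi]; ring

lemma Lg_self {ρ : Matrix n n ℂ} {U : Matrix n m ℂ} {p : m → ℝ} (h : Dg ρ U p) :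
    Lg ρ U p = ∑ i, p i * Real.log (p i) := by
  have : Uᴴ * ρ * U = Matrix.diagonal (fun i => (p i : ℂ)) := by
    rw [h.eq, show Uᴴ * (U * diagonal (fun i => (p i : ℂ)) * Uᴴ) * U
      = (Uᴴ * U) * diagonal (fun i => (p i : ℂ)) * (Uᴴ * U) by simp only [Matrix.mul_assoc], h.uu]
    simp
  rw [Lg, this]; simp

lemma trace_eq {ρ : Matrix n n ℂ} {U : Matrix n m ℂ} {p : m → ℝ} (h : Dg ρ U p) :
    ρ.trace.re = ∑ i, p i := by
  rw [h.eq, Matrix.trace_mul_comm, ← Matrix.mul_assoc, h.uu, Matrix.one_mul, Matrix.trace_diagonal]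
  simp

/-- support condition implies the weighted statement -/
lemma supp_W {ρ : Matrix n n ℂ} {U : Matrix n m ℂ} {p : m → ℝ} (h : Dg ρ U p)
    (hp : ∀ i, 0 ≤ p i) {V : Matrix n l ℂ} {q : l → ℝ}
    (hs : ∀ j, q j = 0 → ((Vᴴ * ρ * V) j j).re = 0) (i : m) (j : l) (hq : q j = 0)
    (hW : Wt U V i j ≠ 0) : p i = 0 := by
  have h1 := sum_Wt_left h (V := V) j
  rw [hs j hq, Finset.sum_eq_zero_iff_of_nonneg
    (fun i _ => mul_nonneg (Wt_nonneg _ _ _ _) (hp i))] at h1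
  exact (mul_eq_zero.1 (h1 i (Finset.mem_univ _))).resolve_left hW

lemma phi_nonneg {p q : ℝ} (hp : 0 ≤ p) (hq : 0 < q) : 0 ≤ phi p q := by
  rcases hp.eq_or_lt with rfl | hp
  · simp [phi, hq.le]
  · have := Real.log_le_sub_one_of_pos (div_pos hq hp)
    rw [Real.log_div hq.ne' hp.ne'] at this
    have h2 := mul_le_mul_of_nonneg_left this hp.le
    have h3 : p * (q / p - 1) = q - p := by field_simp
    rw [phi]; linarith

lemma phi_le {p q : ℝ} (hp : 0 ≤ p) (hq : 0 < q) : phi p q ≤ (p - q) ^ 2 / q := by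
  have h3 : (p - q) ^ 2 / q = p * (p / q - 1) - p + q := by field_simp; ring
  rw [h3]
  rcases hp.eq_or_lt with rfl | hp
  · simp [phi]
  · have := Real.log_le_sub_one_of_pos (div_pos hp hq)
    rw [Real.log_div hp.ne' hq.ne'] at this
    have h2 := mul_le_mul_of_nonneg_left this hp.le
    rw [phi]; linarith

lemma Dn_nonneg {ρ : Matrix n n ℂ} {U : Matrix n m ℂ} {p : m → ℝ} (h : Dg ρ U p)
    (hp : ∀ i, 0 ≤ p i) {V : Matrix n l ℂ} {q : l → ℝ} (hq : ∀ i, 0 ≤ q i)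
    (hs : ∀ j, q j = 0 → ((Vᴴ * ρ * V) j j).re = 0) : 0 ≤ Dn U p V q := by
  refine Finset.sum_nonneg fun i _ => Finset.sum_nonneg fun j _ => ?_
  by_cases hW : Wt U V i j = 0
  · simp [hW]
  refine mul_nonneg (Wt_nonneg _ _ _ _) ?_
  rcases (hq j).eq_or_lt with h0 | h0
  · rw [supp_W h hp hs i j h0.symm hW, ← h0]; simp [phi]
  · exact phi_nonneg (hp i) h0

lemma Dn_le {ρ : Matrix n n ℂ} {U : Matrix n m ℂ} {p : m → ℝ} (h : Dg ρ U p)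
    (hp : ∀ i, 0 ≤ p i) {σ : Matrix n n ℂ} {V : Matrix n l ℂ} {q : l → ℝ} (k : Dg σ V q)
    (hq : ∀ i, 0 ≤ q i)
    (hs : ∀ j, q j = 0 → ((Vᴴ * ρ * V) j j).re = 0) :
    Dn U p V q ≤ ∑ j, ((Vᴴ * ((ρ - σ)ᴴ * (ρ - σ)) * V) j j).re / q j := by
  have e1 : Uᴴ * (ρ - σ) * V = diagonal (fun i => (p i : ℂ)) * (Uᴴ * V)
      - (Uᴴ * V) * diagonal (fun i => (q i : ℂ)) := by
    rw [Matrix.mul_sub, Matrix.sub_mul]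
    congr 1
    · rw [h.eq, ← Matrix.mul_assoc, ← Matrix.mul_assoc, h.uu, Matrix.one_mul, Matrix.mul_assoc]
    · rw [k.eq, ← Matrix.mul_assoc, ← Matrix.mul_assoc, Matrix.mul_assoc, k.uu, Matrix.mul_one]
  have e2 : Vᴴ * ((ρ - σ)ᴴ * (ρ - σ)) * V = (Uᴴ * (ρ - σ) * V)ᴴ * (Uᴴ * (ρ - σ) * V) := by
    rw [conjTranspose_mul, conjTranspose_mul, conjTranspose_conjTranspose]
    rw [show Vᴴ * ((ρ - σ)ᴴ * U) * (Uᴴ * (ρ - σ) * V)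
      = Vᴴ * ((ρ - σ)ᴴ * (U * Uᴴ) * (ρ - σ)) * V by simp only [Matrix.mul_assoc], h.uu',
      Matrix.mul_one]
  rw [Dn, Finset.sum_comm]
  refine Finset.sum_le_sum fun j _ => ?_
  rw [e2, Matrix.mul_apply, Complex.re_sum, Finset.sum_div]
  refine Finset.sum_le_sum fun i _ => ?_
  have e3 : (((Uᴴ * (ρ - σ) * V)ᴴ j i * (Uᴴ * (ρ - σ) * V) i j)).re
      = Wt U V i j * (p i - q j) ^ 2 := by
    rw [conjTranspose_apply, e1, Matrix.sub_apply, Matrix.diagonal_mul, Matrix.mul_diagonal, Wt,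
      Complex.normSq_apply]
    simp only [Complex.star_def, Complex.mul_re, Complex.mul_im, Complex.conj_re, Complex.conj_im,
      Complex.ofReal_re, Complex.ofReal_im, Complex.sub_re, Complex.sub_im]
    ring
  rw [e3, mul_div_assoc]
  by_cases hW : Wt U V i j = 0
  · simp [hW]
  refine mul_le_mul_of_nonneg_left ?_ (Wt_nonneg _ _ _ _)
  rcases (hq j).eq_or_lt with h0 | h0
  · rw [supp_W h hp hs i j h0.symm hW, ← h0]; simp [phi]
  · exact phi_le (hp i) h0

/-- summand of the resolvent quadratic form -/
def Fr (t p q : ℝ) : ℝ := (p - q) ^ 2 / (p + t * q)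

lemma Gv_eq {ρ : Matrix n n ℂ} {U : Matrix n m ℂ} {p : m → ℝ} (h : Dg ρ U p)
    {σ : Matrix n n ℂ} {V : Matrix n l ℂ} {q : l → ℝ} (k : Dg σ V q) (t : ℝ)
    (Y : Matrix m l ℂ) :
    Gv t ρ σ (U * Y * Vᴴ) = ∑ i, ∑ j, (2 * (star (Y i j) * (Uᴴ * V) i j).re * (p i - q j)
      - (p i + t * q j) * Complex.normSq (Y i j)) := by
  have a1 : ((U * Y * Vᴴ)ᴴ * ρ).trace
      = (Yᴴ * (diagonal (fun i => (p i : ℂ)) * (Uᴴ * V))).trace := by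
    rw [h.eq, conjTranspose_mul, conjTranspose_mul, conjTranspose_conjTranspose]
    rw [show V * (Yᴴ * Uᴴ) * (U * diagonal (fun i => (p i : ℂ)) * Uᴴ)
      = V * (Yᴴ * (Uᴴ * U) * diagonal (fun i => (p i : ℂ)) * Uᴴ) by simp only [Matrix.mul_assoc]]
    rw [h.uu, Matrix.trace_mul_comm]; simp only [Matrix.mul_assoc, Matrix.one_mul]
  have a2 : ((U * Y * Vᴴ)ᴴ * σ).trace
      = (Yᴴ * ((Uᴴ * V) * diagonal (fun i => (q i : ℂ)))).trace := by
    rw [k.eq, conjTranspose_mul, conjTranspose_mul, conjTranspose_conjTranspose]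
    rw [show V * (Yᴴ * Uᴴ) * (V * diagonal (fun i => (q i : ℂ)) * Vᴴ)
      = V * (Yᴴ * Uᴴ * (V * diagonal (fun i => (q i : ℂ))) * Vᴴ) by simp only [Matrix.mul_assoc]]
    rw [Matrix.trace_mul_comm]
    simp only [Matrix.mul_assoc, k.uu, Matrix.mul_one]
  have a3 : (ρ * ((U * Y * Vᴴ) * (U * Y * Vᴴ)ᴴ)).trace
      = (Yᴴ * (diagonal (fun i => (p i : ℂ)) * Y)).trace := by
    rw [h.eq, conjTranspose_mul, conjTranspose_mul, conjTranspose_conjTranspose]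
    rw [show (U * diagonal (fun i => (p i : ℂ)) * Uᴴ) * (U * Y * Vᴴ * (V * (Yᴴ * Uᴴ)))
      = U * (diagonal (fun i => (p i : ℂ)) * (Uᴴ * U) * Y * (Vᴴ * V) * Yᴴ * Uᴴ) by
        simp only [Matrix.mul_assoc]]
    rw [h.uu, k.uu, Matrix.trace_mul_comm]
    simp only [Matrix.mul_assoc, h.uu, Matrix.mul_one, Matrix.one_mul]
    rw [← Matrix.mul_assoc, Matrix.trace_mul_comm]
  have a4 : (σ * ((U * Y * Vᴴ)ᴴ * (U * Y * Vᴴ))).trace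
      = (Yᴴ * (Y * diagonal (fun i => (q i : ℂ)))).trace := by
    rw [k.eq, conjTranspose_mul, conjTranspose_mul, conjTranspose_conjTranspose]
    rw [show (V * diagonal (fun i => (q i : ℂ)) * Vᴴ) * (V * (Yᴴ * Uᴴ) * (U * Y * Vᴴ))
      = V * (diagonal (fun i => (q i : ℂ)) * (Vᴴ * V) * Yᴴ * (Uᴴ * U) * Y * Vᴴ) by
        simp only [Matrix.mul_assoc]]
    rw [h.uu, k.uu, Matrix.trace_mul_comm]
    simp only [Matrix.mul_assoc, k.uu, Matrix.mul_one, Matrix.one_mul]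
    rw [Matrix.trace_mul_comm, Matrix.mul_assoc]
  have tr : ∀ Z : Matrix m l ℂ, (Yᴴ * Z).trace.re = ∑ i, ∑ j, (star (Y i j) * Z i j).re := by
    intro Z
    rw [Finset.sum_comm, Matrix.trace, Complex.re_sum]
    refine Finset.sum_congr rfl fun j _ => ?_
    rw [Matrix.diag_apply, Matrix.mul_apply, Complex.re_sum]
    rfl
  rw [Gv, a1, a2, a3, a4, Complex.sub_re, tr, tr, tr, tr]
  simp only [← Finset.sum_sub_distrib, Finset.mul_sum]
  refine Finset.sum_congr rfl fun i _ => Finset.sum_congr rfl fun j _ => ?_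
  rw [Matrix.diagonal_mul, Matrix.mul_diagonal, Matrix.diagonal_mul, Matrix.mul_diagonal,
      Complex.normSq_apply]
  simp only [Complex.star_def, Complex.mul_re, Complex.mul_im, Complex.conj_re, Complex.conj_im,
      Complex.ofReal_re, Complex.ofReal_im]
  ring

lemma Gv_le {ρ : Matrix n n ℂ} {U : Matrix n m ℂ} {p : m → ℝ} (h : Dg ρ U p)
    (hp : ∀ i, 0 ≤ p i)
    {σ : Matrix n n ℂ} {V : Matrix n l ℂ} {q : l → ℝ} (k : Dg σ V q) (hq : ∀ j, 0 ≤ q j)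
    {t : ℝ} (ht : 0 < t) (X : Matrix n n ℂ) :
    Gv t ρ σ X ≤ ∑ i, ∑ j, Wt U V i j * Fr t (p i) (q j) := by
  have hX : X = U * (Uᴴ * X * V) * Vᴴ := by
    rw [show U * (Uᴴ * X * V) * Vᴴ = (U * Uᴴ) * X * (V * Vᴴ) by simp only [Matrix.mul_assoc],
      h.uu', k.uu', Matrix.mul_one, Matrix.one_mul]
  rw [hX, Gv_eq h k]
  refine Finset.sum_le_sum fun i _ => Finset.sum_le_sum fun j _ => ?_
  generalize (Uᴴ * X * V) i j = y
  rw [Wt, Fr]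
  generalize (Uᴴ * V) i j = z
  have hpi := hp i
  have hqj := mul_nonneg ht.le (hq j)
  rcases (add_nonneg hpi hqj).eq_or_lt with h0 | h0
  · have hp0 : p i = 0 := by linarith
    have hq0 : q j = 0 := by
      have : t * q j = 0 := by linarith
      exact (mul_eq_zero.1 this).resolve_left ht.ne'
    simp [hp0, hq0]
  · rw [← mul_div_assoc, le_div_iff₀ h0]
    simp only [Complex.normSq_apply, Complex.star_def, Complex.mul_re, Complex.conj_re,
      Complex.conj_im]
    nlinarith [sq_nonneg (z.re * (p i - q j) - (p i + t * q j) * y.re),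
      sq_nonneg (z.im * (p i - q j) - (p i + t * q j) * y.im)]

lemma Gv_attained {ρ : Matrix n n ℂ} {U : Matrix n m ℂ} {p : m → ℝ} (h : Dg ρ U p)
    (hp : ∀ i, 0 ≤ p i)
    {σ : Matrix n n ℂ} {V : Matrix n l ℂ} {q : l → ℝ} (k : Dg σ V q) (hq : ∀ j, 0 ≤ q j)
    {t : ℝ} (ht : 0 < t) :
    ∃ X, Gv t ρ σ X = ∑ i, ∑ j, Wt U V i j * Fr t (p i) (q j) := by
  refine ⟨U * (Matrix.of fun i j => (((p i - q j) / (p i + t * q j) : ℝ) : ℂ) * (Uᴴ * V) i j) * Vᴴ,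
    ?_⟩
  rw [Gv_eq h k]
  refine Finset.sum_congr rfl fun i _ => Finset.sum_congr rfl fun j _ => ?_
  rw [Matrix.of_apply, Wt, Fr]
  generalize (Uᴴ * V) i j = z
  have hpi := hp i
  have hqj := mul_nonneg ht.le (hq j)
  simp only [Complex.normSq_apply, Complex.star_def, Complex.mul_re, Complex.mul_im,
    Complex.conj_re, Complex.conj_im, Complex.ofReal_re, Complex.ofReal_im]
  rcases (add_nonneg hpi hqj).eq_or_lt with h0 | h0
  · rw [← h0]
    have hp0 : p i = 0 := by linarith
    have hq0 : q j = 0 := by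
      have : t * q j = 0 := by linarith
      exact (mul_eq_zero.1 this).resolve_left ht.ne'
    simp [hp0, hq0]
  · have h1 : (p i - q j) = (p i - q j) / (p i + t * q j) * (p i + t * q j) :=
      (div_mul_cancel₀ _ h0.ne').symm
    have h2 : (p i - q j) ^ 2 / (p i + t * q j)
        = ((p i - q j) / (p i + t * q j)) ^ 2 * (p i + t * q j) := by
      field_simp
    rw [h2]
    generalize (p i - q j) / (p i + t * q j) = r at *
    rw [h1]
    ring

end QITaux

namespace QITaux

open Matrix QIT MeasureTheory Set Filter Topology

set_option linter.unusedSectionVars false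
set_option linter.unusedSimpArgs false

lemma scalar_aux {p q : ℝ} (hp : 0 ≤ p) (hq : 0 < q) :
    ContinuousWithinAt (fun t : ℝ => -(p * Real.log (q + (p - q) * (1 + t)⁻¹)) + (p - q) * (1 + t)⁻¹)
      (Ici 0) 0 ∧
    (∀ t ∈ Ioi (0 : ℝ), HasDerivAt
      (fun t : ℝ => -(p * Real.log (q + (p - q) * (1 + t)⁻¹)) + (p - q) * (1 + t)⁻¹)
      (t / (1 + t) ^ 2 * Fr t p q) t) ∧
    (∀ t ∈ Ioi (0 : ℝ), 0 ≤ t / (1 + t) ^ 2 * Fr t p q) ∧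
    Tendsto (fun t : ℝ => -(p * Real.log (q + (p - q) * (1 + t)⁻¹)) + (p - q) * (1 + t)⁻¹) atTop
      (𝓝 (-(p * Real.log q))) := by
  have hinv : ContinuousAt (fun t : ℝ => (p - q) * (1 + t)⁻¹) 0 := by
    refine ContinuousAt.mul continuousAt_const (ContinuousAt.inv₀ (by fun_prop) (by norm_num))
  refine ⟨?_, ?_, ?_, ?_⟩
  · apply ContinuousAt.continuousWithinAt
    rcases hp.eq_or_lt with rfl | hp
    · simpa using hinv
    · refine ContinuousAt.add (ContinuousAt.neg (continuousAt_const.mul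
        (ContinuousAt.log (continuousAt_const.add hinv) ?_))) hinv
      simp [hp.ne']
  · intro t ht
    have ht : 0 < t := ht
    have h1 : (1 + t) ≠ 0 := by positivity
    have h2 : 0 < p + t * q := by positivity
    have h3 : q + (p - q) * (1 + t)⁻¹ = (p + t * q) / (1 + t) := by field_simp; ring
    have h4 : q + (p - q) * (1 + t)⁻¹ ≠ 0 := by rw [h3]; positivity
    have d1 : HasDerivAt (fun t : ℝ => (p - q) * (1 + t)⁻¹) ((p - q) * (-1 / (1 + t) ^ 2)) t :=
      (((hasDerivAt_id t).const_add 1).inv h1).const_mul (p - q)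
    have d2 := (((d1.const_add q).log h4).const_mul p).neg.add d1
    refine d2.congr_deriv ?_
    rw [h3, Fr]
    have := h2.ne'
    field_simp
    ring
  · intro t ht
    have ht : 0 < t := ht
    rw [Fr]; positivity
  · have h0 : Tendsto (fun t : ℝ => (p - q) * (1 + t)⁻¹) atTop (𝓝 0) := by
      have : Tendsto (fun t : ℝ => (1 + t)⁻¹) atTop (𝓝 0) :=
        tendsto_inv_atTop_zero.comp (tendsto_atTop_add_const_left _ _ tendsto_id)
      simpa using this.const_mul (p - q)
    have h1 : Tendsto (fun t : ℝ => q + (p - q) * (1 + t)⁻¹) atTop (𝓝 q) := by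
      simpa using h0.const_add q
    have h2 := ((h1.log hq.ne').const_mul p).neg.add h0
    simpa using h2

lemma scalar_int {p q : ℝ} (hp : 0 ≤ p) (hq : 0 < q) :
    IntegrableOn (fun t : ℝ => t / (1 + t) ^ 2 * Fr t p q) (Ioi 0) ∧
      ∫ t in Ioi (0 : ℝ), t / (1 + t) ^ 2 * Fr t p q = phi p q := by
  obtain ⟨h1, h2, h3, h4⟩ := scalar_aux hp hq
  refine ⟨integrableOn_Ioi_deriv_of_nonneg h1 h2 h3 h4, ?_⟩
  rw [integral_Ioi_of_hasDerivAt_of_nonneg h1 h2 h3 h4, phi]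
  simp
  ring

variable {n m l : Type*} [Fintype n] [DecidableEq n] [Fintype m] [DecidableEq m]
  [Fintype l] [DecidableEq l]

lemma Dn_int {ρ : Matrix n n ℂ} {U : Matrix n m ℂ} {p : m → ℝ} (h : Dg ρ U p)
    (hp : ∀ i, 0 ≤ p i) {V : Matrix n l ℂ} {q : l → ℝ} (hq : ∀ i, 0 ≤ q i)
    (hs : ∀ j, q j = 0 → ((Vᴴ * ρ * V) j j).re = 0) :
    IntegrableOn (fun t : ℝ => ∑ i, ∑ j, Wt U V i j * (t / (1 + t) ^ 2 * Fr t (p i) (q j))) (Ioi 0)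
    ∧ ∫ t in Ioi (0 : ℝ), ∑ i, ∑ j, Wt U V i j * (t / (1 + t) ^ 2 * Fr t (p i) (q j))
      = Dn U p V q := by
  have key : ∀ i j, IntegrableOn (fun t : ℝ => Wt U V i j * (t / (1 + t) ^ 2 * Fr t (p i) (q j)))
      (Ioi 0) ∧ ∫ t in Ioi (0 : ℝ), Wt U V i j * (t / (1 + t) ^ 2 * Fr t (p i) (q j))
        = Wt U V i j * phi (p i) (q j) := by
    intro i j
    by_cases hW : Wt U V i j = 0
    · simp [hW]
    rcases (hq j).eq_or_lt with h0 | h0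
    · rw [supp_W h hp hs i j h0.symm hW, ← h0]; simp [phi, Fr]
    · obtain ⟨a, b⟩ := scalar_int (hp i) h0
      refine ⟨a.const_mul _, ?_⟩
      rw [integral_const_mul, b]
  constructor
  · exact integrable_finsetSum _ fun i _ => integrable_finsetSum _ fun j _ => (key i j).1
  · rw [integral_finsetSum _ fun i _ => integrable_finsetSum _ fun j _ => (key i j).1]
    refine Finset.sum_congr rfl fun i _ => ?_
    rw [integral_finsetSum _ fun j _ => (key i j).1]
    exact Finset.sum_congr rfl fun j _ => (key i j).2

variable {n' m' l' : Type*} [Fintype n'] [DecidableEq n'] [Fintype m'] [DecidableEq m']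
  [Fintype l'] [DecidableEq l']

theorem Dn_mono {ρ : Matrix n n ℂ} {U : Matrix n m ℂ} {p : m → ℝ} (h : Dg ρ U p)
    (hp : ∀ i, 0 ≤ p i) {σ : Matrix n n ℂ} {V : Matrix n l ℂ} {q : l → ℝ} (k : Dg σ V q)
    (hq : ∀ i, 0 ≤ q i) (hs : ∀ j, q j = 0 → ((Vᴴ * ρ * V) j j).re = 0)
    {ρ' : Matrix n' n' ℂ} {U' : Matrix n' m' ℂ} {p' : m' → ℝ} (h' : Dg ρ' U' p')
    (hp' : ∀ i, 0 ≤ p' i) {σ' : Matrix n' n' ℂ} {V' : Matrix n' l' ℂ} {q' : l' → ℝ}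
    (k' : Dg σ' V' q')
    (hq' : ∀ i, 0 ≤ q' i) (hs' : ∀ j, q' j = 0 → ((V'ᴴ * ρ' * V') j j).re = 0)
    (ι : Matrix n' n' ℂ → Matrix n n ℂ) (hmul : ∀ X Y, ι (X * Y) = ι X * ι Y)
    (hstar : ∀ X, ι Xᴴ = (ι X)ᴴ) (hρ : ∀ X, (ρ * ι X).trace = (ρ' * X).trace)
    (hσ : ∀ X, (σ * ι X).trace = (σ' * X).trace) :
    Dn U' p' V' q' ≤ Dn U p V q := by
  obtain ⟨a, b⟩ := Dn_int h hp hq hs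
  obtain ⟨a', b'⟩ := Dn_int h' hp' hq' hs'
  rw [← b, ← b']
  refine setIntegral_mono_on a' a measurableSet_Ioi fun t ht => ?_
  have ht : 0 < t := ht
  obtain ⟨X, hX⟩ := Gv_attained h' hp' k' hq' ht
  have h1 := Gv_le h hp k hq ht (ι X)
  have h2 : Gv t ρ σ (ι X) = Gv t ρ' σ' X := by
    rw [Gv, Gv, ← hstar, ← hmul, ← hmul, hρ, hσ, Matrix.trace_mul_comm _ ρ,
      Matrix.trace_mul_comm _ σ, hρ, hσ, Matrix.trace_mul_comm _ ρ', Matrix.trace_mul_comm _ σ']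
  rw [h2, hX] at h1
  have e : ∀ (w r f : ℝ), w * (r * f) = r * (w * f) := fun w r f => by ring
  simp only [e, ← Finset.mul_sum]
  exact mul_le_mul_of_nonneg_left h1 (by positivity)

end QITaux

namespace QITaux

open Matrix QIT Set Filter Topology
open scoped Kronecker

set_option linter.unusedSectionVars false
set_option linter.unusedSimpArgs false

variable {n m l : Type*} [Fintype n] [DecidableEq n] [Fintype m] [DecidableEq m]
  [Fintype l] [DecidableEq l]

/-- negative entropy in nats -/
def eta (X : Matrix n n ℂ) : ℝ := -(vN X * Real.log 2)

lemma exists_dg {X : Matrix n n ℂ} (hX : X.PosSemidef) :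
    ∃ (U : Matrix n n ℂ) (p : n → ℝ), Dg X U p ∧ (∀ i, 0 ≤ p i) ∧
      eta X = ∑ i, p i * Real.log (p i) ∧
      ∀ Y : Matrix n n ℂ, (Y * matLog X).trace.re * Real.log 2 = Lg Y U p := by
  have hl : Real.log 2 ≠ 0 := (Real.log_pos one_lt_two).ne'
  have hu : (hX.1.eigenvectorUnitary : Matrix n n ℂ)ᴴ * (hX.1.eigenvectorUnitary : Matrix n n ℂ) = 1 :=
    Matrix.mem_unitaryGroup_iff'.1 hX.1.eigenvectorUnitary.2
  have hu' : (hX.1.eigenvectorUnitary : Matrix n n ℂ) * (hX.1.eigenvectorUnitary : Matrix n n ℂ)ᴴ = 1 :=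
    Matrix.mem_unitaryGroup_iff.1 hX.1.eigenvectorUnitary.2
  refine ⟨hX.1.eigenvectorUnitary, hX.1.eigenvalues, ⟨hu, hu', ?_⟩, hX.eigenvalues_nonneg, ?_, ?_⟩
  · exact hX.1.spectral_theorem
  · rw [eta, vN, dif_pos hX.1, neg_mul, neg_neg, Finset.sum_mul]
    refine Finset.sum_congr rfl fun i _ => ?_
    rw [xlog]
    split_ifs with h
    · simp [h]
    · rw [Real.logb]; field_simp
  · intro Y
    rw [matLog, dif_pos hX.1, Matrix.star_eq_conjTranspose]
    generalize (hX.1.eigenvectorUnitary : Matrix n n ℂ) = U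
    rw [← Matrix.mul_assoc, Matrix.trace_mul_comm, ← Matrix.mul_assoc, ← Matrix.mul_assoc, Lg,
      Matrix.trace, Complex.re_sum, Finset.sum_mul]
    refine Finset.sum_congr rfl fun i _ => ?_
    rw [Matrix.diag_apply, Matrix.mul_diagonal, Complex.re_mul_ofReal, mul_assoc]
    congr 1
    split_ifs with h
    · simp [h]
    · rw [Real.logb]; field_simp

lemma Lg_lin (a b : ℝ) (X Y : Matrix n n ℂ) (V : Matrix n l ℂ) (q : l → ℝ) :
    Lg (a • X + b • Y) V q = a * Lg X V q + b * Lg Y V q := by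
  rw [Lg, Lg, Lg, Finset.mul_sum, Finset.mul_sum, ← Finset.sum_add_distrib]
  refine Finset.sum_congr rfl fun i _ => ?_
  simp only [Matrix.mul_add, Matrix.add_mul, Matrix.mul_smul, Matrix.smul_mul, Matrix.add_apply,
    Matrix.smul_apply, Complex.add_re, Complex.smul_re, smul_eq_mul]
  ring

lemma diag_re_nonneg {X : Matrix n n ℂ} (hX : X.PosSemidef) (V : Matrix n l ℂ) (j : l) :
    0 ≤ ((Vᴴ * X * V) j j).re := by
  have := (hX.conjTranspose_mul_mul_same V).diag_nonneg (i := j)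
  exact (Complex.nonneg_iff.1 this).1

lemma dg_diag {Z : Matrix n n ℂ} {V : Matrix n l ℂ} {q : l → ℝ} (k : Dg Z V q) :
    Vᴴ * Z * V = Matrix.diagonal (fun i => (q i : ℂ)) := by
  rw [k.eq, show Vᴴ * (V * diagonal (fun i => (q i : ℂ)) * Vᴴ) * V
      = (Vᴴ * V) * diagonal (fun i => (q i : ℂ)) * (Vᴴ * V) by simp only [Matrix.mul_assoc], k.uu]
  simp

lemma mix_supp {X Y Z : Matrix n n ℂ} (hX : X.PosSemidef) (hY : Y.PosSemidef) {s : ℝ}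
    (hs : 0 < s) (hs1 : s < 1) (hZ : Z = s • X + (1 - s) • Y)
    {V : Matrix n l ℂ} {q : l → ℝ} (k : Dg Z V q) (j : l) (hq : q j = 0) :
    ((Vᴴ * X * V) j j).re = 0 ∧ ((Vᴴ * Y * V) j j).re = 0 := by
  have h1 : ((Vᴴ * Z * V) j j).re = 0 := by rw [dg_diag k]; simp [hq]
  rw [hZ] at h1
  simp only [Matrix.mul_add, Matrix.add_mul, Matrix.mul_smul, Matrix.smul_mul, Matrix.add_apply,
    Matrix.smul_apply, Complex.add_re, Complex.smul_re, smul_eq_mul] at h1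
  have hx := diag_re_nonneg hX V j
  have hy := diag_re_nonneg hY V j
  have h1s : 0 < 1 - s := by linarith
  have e1 := mul_nonneg hs.le hx
  have e2 := mul_nonneg h1s.le hy
  constructor
  · exact (mul_eq_zero.1 (by linarith : s * _ = 0)).resolve_left hs.ne'
  · exact (mul_eq_zero.1 (by linarith : (1 - s) * _ = 0)).resolve_left h1s.ne'

lemma conv_nonneg {X Y Z : Matrix n n ℂ} (hX : X.PosSemidef) (hY : Y.PosSemidef)
    (hZ' : Z.PosSemidef) {s : ℝ}
    (hs : 0 < s) (hs1 : s < 1) (hZ : Z = s • X + (1 - s) • Y)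
    (tX : X.trace = 1) (tY : Y.trace = 1) (tZ : Z.trace = 1) :
    0 ≤ s * eta X + (1 - s) * eta Y - eta Z := by
  obtain ⟨U, p, h, hp, eX, -⟩ := exists_dg hX
  obtain ⟨U', p', h', hp', eY, -⟩ := exists_dg hY
  obtain ⟨V, q, k, hq, eZ, -⟩ := exists_dg hZ'
  have d1 := Dn_nonneg h hp hq (fun j hj => (mix_supp hX hY hs hs1 hZ k j hj).1)
  have d2 := Dn_nonneg h' hp' hq (fun j hj => (mix_supp hX hY hs hs1 hZ k j hj).2)
  rw [Dn_eq h k, ← trace_eq h, ← trace_eq k, ← eX, tX, tZ] at d1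
  rw [Dn_eq h' k, ← trace_eq h', ← trace_eq k, ← eY, tY, tZ] at d2
  have e := Lg_lin s (1 - s) X Y V q
  rw [← hZ, Lg_self k, ← eZ] at e
  have h1s : 0 < 1 - s := by linarith
  nlinarith

lemma conv_upper {X Z : Matrix n n ℂ} (hX : X.PosSemidef)
    (hZ' : Z.PosSemidef) (tX : X.trace = 1) (tZ : Z.trace = 1) :
    ∃ K : ℝ, ∀ (s : ℝ) (Y : Matrix n n ℂ), 0 < s → s < 1 → Y.PosSemidef → Y.trace = 1 →
      Z = s • X + (1 - s) • Y →
      s * eta X + (1 - s) * eta Y - eta Z ≤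
        s * ((X * (matLog X - matLog Z)).trace.re * Real.log 2)
          + (1 - s) * ((s / (1 - s)) ^ 2 * K) := by
  obtain ⟨U, p, h, hp, eX, lX⟩ := exists_dg hX
  obtain ⟨V, q, k, hq, eZ, lZ⟩ := exists_dg hZ'
  refine ⟨∑ j, ((Vᴴ * ((Z - X)ᴴ * (Z - X)) * V) j j).re / q j, fun s Y hs hs1 hY tY hZ => ?_⟩
  obtain ⟨U', p', h', hp', eY, -⟩ := exists_dg hY
  have h1s : 0 < 1 - s := by linarith
  have d2 := Dn_le h' hp' k hq (fun j hj => (mix_supp hX hY hs hs1 hZ k j hj).2)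
  have e0 : Y - Z = (s / (1 - s)) • (Z - X) := by
    have : (1 - s) • (Y - Z) = s • (Z - X) := by rw [hZ]; module
    rw [div_eq_inv_mul, mul_smul, ← this, smul_smul, inv_mul_cancel₀ h1s.ne', one_smul]
  have e1 : ∑ j, ((Vᴴ * ((Y - Z)ᴴ * (Y - Z)) * V) j j).re / q j
      = (s / (1 - s)) ^ 2 * ∑ j, ((Vᴴ * ((Z - X)ᴴ * (Z - X)) * V) j j).re / q j := by
    rw [e0, Finset.mul_sum]
    refine Finset.sum_congr rfl fun j _ => ?_
    simp only [conjTranspose_smul, Matrix.mul_smul, Matrix.smul_mul, Matrix.smul_apply,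
      Complex.smul_re, smul_eq_mul, star_trivial]
    ring
  rw [e1, Dn_eq h' k, ← trace_eq h', ← trace_eq k, ← eY, tY, tZ] at d2
  have e := Lg_lin s (1 - s) X Y V q
  rw [← hZ, Lg_self k, ← eZ] at e
  have e3 : (X * (matLog X - matLog Z)).trace.re * Real.log 2 = eta X - Lg X V q := by
    rw [Matrix.mul_sub, Matrix.trace_sub, Complex.sub_re, sub_mul, lX, lZ, Lg_self h, eX]
  rw [e3]
  have d3 := mul_le_mul_of_nonneg_left d2 h1s.le
  nlinarith

variable {A B C : Type*} [Fintype A] [DecidableEq A] [Fintype B] [DecidableEq B]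
  [Fintype C] [DecidableEq C]

lemma ptrFst_psd {X : Matrix (A × B) (A × B) ℂ} (hX : X.PosSemidef) : (ptrFst X).PosSemidef := by
  have : ptrFst X = ∑ i, X.submatrix (fun b => (i, b)) (fun b => (i, b)) := by
    ext b b'; simp [ptrFst, Matrix.sum_apply]
  rw [this]
  exact posSemidef_sum _ fun i _ => hX.submatrix _

lemma ptrSnd_psd {X : Matrix (A × B) (A × B) ℂ} (hX : X.PosSemidef) : (ptrSnd X).PosSemidef := by
  have : ptrSnd X = ∑ i, X.submatrix (fun b => (b, i)) (fun b => (b, i)) := by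
    ext b b'; simp [ptrSnd, Matrix.sum_apply]
  rw [this]
  exact posSemidef_sum _ fun i _ => hX.submatrix _

lemma ptrC3_psd {X : Matrix (A × B × C) (A × B × C) ℂ} (hX : X.PosSemidef) :
    (ptrC3 X).PosSemidef := by
  have : ptrC3 X = ∑ i, X.submatrix (fun b : A × B => (b.1, b.2, i)) (fun b => (b.1, b.2, i)) := by
    ext b b'; simp [ptrC3, Matrix.sum_apply]
  rw [this]
  exact posSemidef_sum _ fun i _ => hX.submatrix _

lemma ptrFst_trace (X : Matrix (A × B) (A × B) ℂ) : (ptrFst X).trace = X.trace := by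
  simp only [Matrix.trace, Matrix.diag_apply, ptrFst, Matrix.of_apply, Fintype.sum_prod_type]
  exact Finset.sum_comm

lemma ptrC3_trace (X : Matrix (A × B × C) (A × B × C) ℂ) : (ptrC3 X).trace = X.trace := by
  simp only [Matrix.trace, Matrix.diag_apply, ptrC3, Matrix.of_apply, Fintype.sum_prod_type]

lemma ptr_B (X : Matrix (A × B × C) (A × B × C) ℂ) : ptrFst (ptrC3 X) = ptrSnd (ptrFst X) := by
  ext b b'
  simp only [ptrFst, ptrC3, ptrSnd, Matrix.of_apply]
  exact Finset.sum_comm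

lemma ptrFst_lin (s t : ℝ) (X Y : Matrix (A × B) (A × B) ℂ) :
    ptrFst (s • X + t • Y) = s • ptrFst X + t • ptrFst Y := by
  ext b b'
  simp [ptrFst, Finset.sum_add_distrib, Finset.mul_sum]

lemma ptrC3_lin (s t : ℝ) (X Y : Matrix (A × B × C) (A × B × C) ℂ) :
    ptrC3 (s • X + t • Y) = s • ptrC3 X + t • ptrC3 Y := by
  ext b b'
  simp [ptrC3, Finset.sum_add_distrib, Finset.mul_sum]

/-- the embedding `X ↦ 1 ⊗ X` -/
def emb (A : Type*) [DecidableEq A] (X : Matrix B B ℂ) : Matrix (A × B) (A × B) ℂ :=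
  (1 : Matrix A A ℂ) ⊗ₖ X

lemma emb_mul (X Y : Matrix B B ℂ) : emb A (X * Y) = emb A X * emb A Y := by
  rw [emb, emb, emb, ← Matrix.mul_kronecker_mul, Matrix.one_mul]

lemma emb_star (X : Matrix B B ℂ) : emb A Xᴴ = (emb A X)ᴴ := by
  rw [emb, emb, Matrix.conjTranspose_kronecker, conjTranspose_one]

lemma emb_trace (M : Matrix (A × B) (A × B) ℂ) (X : Matrix B B ℂ) :
    (M * emb A X).trace = (ptrFst M * X).trace := by
  simp only [Matrix.trace, Matrix.diag_apply, Matrix.mul_apply, emb, kroneckerMap_apply,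
    Matrix.one_apply, Fintype.sum_prod_type, ptrFst, Matrix.of_apply, ite_mul, one_mul, zero_mul,
    mul_ite, mul_zero]
  rw [Finset.sum_comm]
  refine Finset.sum_congr rfl fun b _ => ?_
  simp_rw [Finset.sum_mul]
  rw [Finset.sum_comm (s := (Finset.univ : Finset B))]
  refine Finset.sum_congr rfl fun a _ => ?_
  rw [Finset.sum_comm]
  refine Finset.sum_congr rfl fun b' _ => ?_
  simp

lemma conv_mono {X Y Z : Matrix (A × B) (A × B) ℂ} (hX : X.PosSemidef) (hY : Y.PosSemidef)
    (hZ' : Z.PosSemidef) {s : ℝ}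
    (hs : 0 < s) (hs1 : s < 1) (hZ : Z = s • X + (1 - s) • Y) :
    s * eta (ptrFst X) + (1 - s) * eta (ptrFst Y) - eta (ptrFst Z) ≤
      s * eta X + (1 - s) * eta Y - eta Z := by
  obtain ⟨U, p, h, hp, eX, -⟩ := exists_dg hX
  obtain ⟨U', p', h', hp', eY, -⟩ := exists_dg hY
  obtain ⟨V, q, k, hq, eZ, -⟩ := exists_dg hZ'
  obtain ⟨U2, p2, h2, hp2, eX2, -⟩ := exists_dg (ptrFst_psd hX)
  obtain ⟨U2', p2', h2', hp2', eY2, -⟩ := exists_dg (ptrFst_psd hY)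
  obtain ⟨V2, q2, k2, hq2, eZ2, -⟩ := exists_dg (ptrFst_psd hZ')
  have hZ2 : ptrFst Z = s • ptrFst X + (1 - s) • ptrFst Y := by rw [hZ, ptrFst_lin]
  have c := mix_supp hX hY hs hs1 hZ k
  have c2 := mix_supp (ptrFst_psd hX) (ptrFst_psd hY) hs hs1 hZ2 k2
  have d1 := Dn_mono h hp k hq (fun j hj => (c j hj).1) h2 hp2 k2 hq2 (fun j hj => (c2 j hj).1)
    (emb A) emb_mul emb_star (emb_trace X) (emb_trace Z)
  have d2 := Dn_mono h' hp' k hq (fun j hj => (c j hj).2) h2' hp2' k2 hq2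
    (fun j hj => (c2 j hj).2) (emb A) emb_mul emb_star (emb_trace Y) (emb_trace Z)
  rw [Dn_eq h k, Dn_eq h2 k2, ← trace_eq h, ← trace_eq k, ← trace_eq h2, ← trace_eq k2,
    ptrFst_trace, ptrFst_trace, ← eX, ← eX2] at d1
  rw [Dn_eq h' k, Dn_eq h2' k2, ← trace_eq h', ← trace_eq k, ← trace_eq h2', ← trace_eq k2,
    ptrFst_trace, ptrFst_trace, ← eY, ← eY2] at d2
  have e := Lg_lin s (1 - s) X Y V q
  rw [← hZ, Lg_self k, ← eZ] at e
  have e2 := Lg_lin s (1 - s) (ptrFst X) (ptrFst Y) V2 q2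
  rw [← hZ2, Lg_self k2, ← eZ2] at e2
  have h1s : 0 < 1 - s := by linarith
  nlinarith

/-- generic partial trace along a splitting `N ≃ n × C` -/
def ptrE {N : Type*} (e : N ≃ n × C) (M : Matrix N N ℂ) : Matrix n n ℂ :=
  Matrix.of fun x y => ∑ c, M (e.symm (x, c)) (e.symm (y, c))

/-- `M ⊗ 1` along a splitting -/
def liftE {N : Type*} (e : N ≃ n × C) (M : Matrix n l ℂ) : Matrix N (l × C) ℂ :=
  (M ⊗ₖ (1 : Matrix C C ℂ)).submatrix e id

variable {N : Type*} [Fintype N] [DecidableEq N]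

lemma dg_lift (e : N ≃ n × C) {σ : Matrix n n ℂ} {V : Matrix n l ℂ} {q : l → ℝ} (k : Dg σ V q) :
    Dg ((σ ⊗ₖ (1 : Matrix C C ℂ)).submatrix e e) (liftE e V) (fun x => q x.1) := by
  have hct : (liftE e V : Matrix N (l × C) ℂ)ᴴ = (Vᴴ ⊗ₖ (1 : Matrix C C ℂ)).submatrix id e := by
    rw [liftE, conjTranspose_submatrix, conjTranspose_kronecker, conjTranspose_one]
  have hd : Matrix.diagonal (fun x : l × C => (q x.1 : ℂ))
      = (Matrix.diagonal (fun i => (q i : ℂ))) ⊗ₖ (1 : Matrix C C ℂ) := by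
    rw [← Matrix.diagonal_one, Matrix.diagonal_kronecker_diagonal]; simp
  refine ⟨?_, ?_, ?_⟩
  · rw [hct, liftE, Matrix.submatrix_mul_equiv, ← Matrix.mul_kronecker_mul, k.uu]; simp
  · rw [hct, liftE, ← Matrix.submatrix_mul _ _ _ _ _ Function.bijective_id,
      ← Matrix.mul_kronecker_mul, k.uu']; simp
  · have hd' : Matrix.diagonal (fun x : l × C => (q x.1 : ℂ))
      = ((Matrix.diagonal (fun i => (q i : ℂ))) ⊗ₖ (1 : Matrix C C ℂ)).submatrix id id := by
      rw [hd, submatrix_id_id]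
    rw [hct, liftE, hd', ← Matrix.submatrix_mul _ _ _ _ _ Function.bijective_id,
      ← Matrix.submatrix_mul _ _ _ _ _ Function.bijective_id, ← Matrix.mul_kronecker_mul,
      ← Matrix.mul_kronecker_mul, ← k.eq]
    simp

lemma lift_diag (e : N ≃ n × C) (M : Matrix N N ℂ) (V : Matrix n l ℂ) (i : l) :
    ∑ c, (((liftE e V)ᴴ * M * liftE e V) (i, c) (i, c)) = (Vᴴ * ptrE e M * V) i i := by
  have hM : M = (M.submatrix e.symm e.symm).submatrix e e := by simp
  have h1 : (liftE e V)ᴴ * M * liftE e V = (V ⊗ₖ (1 : Matrix C C ℂ))ᴴ *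
      (M.submatrix e.symm e.symm) * (V ⊗ₖ (1 : Matrix C C ℂ)) := by
    conv_lhs => rw [hM]
    rw [liftE, conjTranspose_submatrix, Matrix.submatrix_mul_equiv, Matrix.submatrix_mul_equiv,
      submatrix_id_id]
  rw [h1]
  simp only [Matrix.mul_apply, Fintype.sum_prod_type, conjTranspose_apply, kroneckerMap_apply,
    Matrix.one_apply, ptrE, Matrix.of_apply, submatrix_apply, mul_ite, mul_one, mul_zero, star_zero,
    apply_ite star, ite_mul, zero_mul, Finset.sum_ite_eq, Finset.sum_ite_eq', Finset.mem_univ,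
    if_true, Finset.sum_mul, Finset.mul_sum]
  rw [Finset.sum_comm]
  refine Finset.sum_congr rfl fun x _ => ?_
  rw [Finset.sum_comm]

lemma lift_Lg (e : N ≃ n × C) (M : Matrix N N ℂ) (V : Matrix n l ℂ) (q : l → ℝ) :
    Lg M (liftE e V) (fun x => q x.1) = Lg (ptrE e M) V q := by
  rw [Lg, Lg, Fintype.sum_prod_type]
  refine Finset.sum_congr rfl fun i _ => ?_
  rw [← lift_diag, Complex.re_sum, Finset.sum_mul]

lemma lift_supp (e : N ≃ n × C) {M : Matrix N N ℂ} (hM : M.PosSemidef) {V : Matrix n l ℂ}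
    {q : l → ℝ} (k : Dg (ptrE e M) V q) (j : l × C) (hj : q j.1 = 0) :
    (((liftE e V)ᴴ * M * liftE e V) j j).re = 0 := by
  have h1 := lift_diag e M V j.1
  rw [dg_diag k, Matrix.diagonal_apply_eq, hj] at h1
  have h2 := congrArg Complex.re h1
  rw [Complex.re_sum, Complex.ofReal_zero, Complex.zero_re,
    Finset.sum_eq_zero_iff_of_nonneg (fun c _ => diag_re_nonneg hM _ _)] at h2
  exact h2 j.2 (Finset.mem_univ _)

theorem ssa {X : Matrix (A × B × C) (A × B × C) ℂ} (hX : X.PosSemidef) :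
    0 ≤ eta X + eta (ptrSnd (ptrFst X)) - eta (ptrC3 X) - eta (ptrFst X) := by
  obtain ⟨U, p, h, hp, eX, -⟩ := exists_dg hX
  obtain ⟨V, q, k, hq, eZ, -⟩ := exists_dg (ptrC3_psd hX)
  obtain ⟨U', p', h', hp', eX', -⟩ := exists_dg (ptrFst_psd hX)
  obtain ⟨V', q', k', hq', eZ', -⟩ := exists_dg (ptrSnd_psd (ptrFst_psd hX))
  have r1 : ptrC3 X = ptrE (Equiv.prodAssoc A B C).symm X := rfl
  have r2 : ptrSnd (ptrFst X) = ptrE (Equiv.refl (B × C)) (ptrFst X) := rfl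
  have kk := dg_lift (Equiv.prodAssoc A B C).symm k
  have kk' := dg_lift (Equiv.refl (B × C)) k'
  have hσ : ptrFst ((ptrC3 X ⊗ₖ (1 : Matrix C C ℂ)).submatrix (Equiv.prodAssoc A B C).symm
      (Equiv.prodAssoc A B C).symm) = (ptrSnd (ptrFst X) ⊗ₖ (1 : Matrix C C ℂ)).submatrix
        (Equiv.refl (B × C)) (Equiv.refl (B × C)) := by
    rw [← ptr_B]
    ext x y
    simp only [ptrFst, Matrix.of_apply, submatrix_apply, kroneckerMap_apply, Finset.sum_mul]
    rfl
  have d := Dn_mono h hp kk (fun i => hq i.1) (lift_supp _ hX (r1 ▸ k)) h' hp' kk'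
    (fun i => hq' i.1) (lift_supp _ (ptrFst_psd hX) (r2 ▸ k')) (emb A) emb_mul emb_star
    (emb_trace X) (fun Y => by rw [emb_trace, hσ])
  rw [Dn_eq h kk, Dn_eq h' kk', ← trace_eq h, ← trace_eq h', ptrFst_trace, lift_Lg, lift_Lg,
    ← r1, ← r2, Lg_self k, Lg_self k', ← eX, ← eX', ← eZ, ← eZ', ← trace_eq kk, ← trace_eq kk',
    ← hσ, ptrFst_trace] at d
  linarith

lemma cmi_eta (X : Matrix (A × B × C) (A × B × C) ℂ) :
    cmi X * Real.log 2 = eta X + eta (ptrSnd (ptrFst X)) - eta (ptrC3 X) - eta (ptrFst X) := by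
  simp only [cmi, eta]; ring

lemma exists_s {ρ μ : Matrix n n ℂ} (hρ : ρ.PosSemidef) (hμ : μ.PosSemidef) (h : suppLe ρ μ) :
    ∃ s0 : ℝ, 0 < s0 ∧ (μ - s0 • ρ).PosSemidef := by
  obtain ⟨V, q, k, hq, -, -⟩ := exists_dg hμ
  have hker : ∀ i j, q j = 0 → (Vᴴ * ρ * V) i j = 0 := by
    intro i j hj
    have h1 : μ.mulVec (fun x => V x j) = 0 := by
      have : μ * V = V * diagonal (fun i => (q i : ℂ)) := by
        conv_lhs => rw [k.eq]
        rw [Matrix.mul_assoc, k.uu, Matrix.mul_one]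
      ext x
      have := congrFun (congrFun this x) j
      rw [Matrix.mul_diagonal, hj, Complex.ofReal_zero, mul_zero, Matrix.mul_apply] at this
      exact this
    have h2 := h _ h1
    rw [Matrix.mul_assoc, Matrix.mul_apply]
    refine Finset.sum_eq_zero fun x _ => ?_
    have : (ρ * V) x j = 0 := by
      have := congrFun h2 x
      rw [Matrix.mul_apply]; exact this
    rw [this, mul_zero]
  have hR : (Vᴴ * ρ * V).IsHermitian := (hρ.conjTranspose_mul_mul_same V).1
  have hker' : ∀ i j, q i = 0 → (Vᴴ * ρ * V) i j = 0 := by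
    intro i j hi
    rw [← hR.apply, hker _ _ hi, star_zero]
  set R := Vᴴ * ρ * V with hRdef
  set D : Matrix n n ℂ := diagonal (fun i => ((Real.sqrt (q i) : ℝ) : ℂ)) with hD
  set Di : Matrix n n ℂ := diagonal (fun i => ((Real.sqrt (q i))⁻¹ : ℂ)) with hDi
  have hDih : Diᴴ = Di := by
    rw [hDi, diagonal_conjTranspose]; congr 1; ext i; simp
  have hDh : Dᴴ = D := by
    rw [hD, diagonal_conjTranspose]; congr 1; ext i; simp
  have hS : (Di * R * Di).PosSemidef := by
    have := (hρ.conjTranspose_mul_mul_same V).conjTranspose_mul_mul_same Di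
    rwa [hDih] at this
  obtain ⟨W, r, kS, hr, -, -⟩ := exists_dg hS
  have hDSD : D * (Di * R * Di) * D = R := by
    ext i j
    rw [Matrix.mul_diagonal, Matrix.diagonal_mul, Matrix.mul_diagonal, Matrix.diagonal_mul]
    by_cases hi : q i = 0
    · rw [hker' i j hi]; simp
    by_cases hj : q j = 0
    · rw [hker i j hj]; simp
    have hi' : ((Real.sqrt (q i) : ℝ) : ℂ) ≠ 0 := by
      exact_mod_cast (Real.sqrt_pos.2 (lt_of_le_of_ne (hq i) (Ne.symm hi))).ne'
    have hj' : ((Real.sqrt (q j) : ℝ) : ℂ) ≠ 0 := by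
      exact_mod_cast (Real.sqrt_pos.2 (lt_of_le_of_ne (hq j) (Ne.symm hj))).ne'
    field_simp
  have hDD : D * D = diagonal (fun i => (q i : ℂ)) := by
    rw [hD, diagonal_mul_diagonal]; congr 1; ext i
    rw [← Complex.ofReal_mul, Real.mul_self_sqrt (hq i)]
  have hVRV : V * R * Vᴴ = ρ := by
    rw [hRdef, show V * (Vᴴ * ρ * V) * Vᴴ = (V * Vᴴ) * ρ * (V * Vᴴ) by
      simp only [Matrix.mul_assoc], k.uu']; simp
  set c : ℝ := 1 + ∑ i, r i with hc
  have hc0 : 0 < c := by have := Finset.sum_nonneg (fun i (_ : i ∈ Finset.univ) => hr i); linarith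
  refine ⟨c⁻¹, inv_pos.2 hc0, ?_⟩
  have hT : ((1 : Matrix n n ℂ) - c⁻¹ • (Di * R * Di)).PosSemidef := by
    have e : (1 : Matrix n n ℂ) - c⁻¹ • (Di * R * Di)
        = W * diagonal (fun i => ((1 - c⁻¹ * r i : ℝ) : ℂ)) * Wᴴ := by
      have : diagonal (fun i => ((1 - c⁻¹ * r i : ℝ) : ℂ))
          = 1 - c⁻¹ • diagonal (fun i => (r i : ℂ)) := by
        ext i j
        by_cases hij : i = j
        · subst hij; simp
        · simp [hij]
      rw [this, Matrix.mul_sub, Matrix.sub_mul, Matrix.mul_one, kS.uu', Matrix.mul_smul,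
        Matrix.smul_mul, ← kS.eq]
    rw [e]
    refine PosSemidef.mul_mul_conjTranspose_same (posSemidef_diagonal_iff.2 fun i => ?_) W
    have : r i ≤ c := by
      have := Finset.single_le_sum (fun i (_ : i ∈ Finset.univ) => hr i) (Finset.mem_univ i)
      linarith
    have h3 : c⁻¹ * r i ≤ 1 := by
      rw [inv_mul_le_iff₀ hc0]; linarith
    exact_mod_cast sub_nonneg.2 h3
  have e : μ - c⁻¹ • ρ = (V * D) * ((1 : Matrix n n ℂ) - c⁻¹ • (Di * R * Di)) * (V * D)ᴴ := by
    rw [conjTranspose_mul, hDh]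
    have : (V * D) * ((1 : Matrix n n ℂ) - c⁻¹ • (Di * R * Di)) * (D * Vᴴ)
        = V * (D * D) * Vᴴ - c⁻¹ • (V * (D * (Di * R * Di) * D) * Vᴴ) := by
      simp only [Matrix.mul_sub, Matrix.sub_mul, Matrix.mul_smul, Matrix.smul_mul,
        Matrix.mul_assoc, Matrix.one_mul, Matrix.mul_one]
    rw [this, hDSD, hDD, hVRV, ← k.eq]
  rw [e]
  exact hT.mul_mul_conjTranspose_same _

theorem main_real {ρ μ : Matrix (A × B × C) (A × B × C) ℂ} (hρ : ρ.PosSemidef)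
    (tρ : ρ.trace = 1) (hμ : μ.PosSemidef) (tμ : μ.trace = 1) (hc : cmi μ = 0)
    (h : suppLe ρ μ) : cmi ρ ≤ (ρ * (matLog ρ - matLog μ)).trace.re := by
  obtain ⟨s0, hs0, hpsd⟩ := exists_s hρ hμ h
  obtain ⟨K, hK⟩ := conv_upper hρ hμ tρ tμ
  have hl : 0 < Real.log 2 := Real.log_pos one_lt_two
  refine le_of_mul_le_mul_right ?_ hl
  set D := (ρ * (matLog ρ - matLog μ)).trace.re * Real.log 2 with hD
  have step : ∀ s : ℝ, 0 < s → s < 1 → s ≤ s0 → cmi ρ * Real.log 2 ≤ D + s / (1 - s) * K := by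
    intro s hs hs1 hss
    have h1s : 0 < 1 - s := by linarith
    have hp : (μ - s • ρ).PosSemidef := by
      have : μ - s • ρ = (μ - s0 • ρ) + (s0 - s) • ρ := by module
      rw [this]
      exact hpsd.add (hρ.smul (by linarith : (0 : ℝ) ≤ s0 - s))
    set σ := (1 - s)⁻¹ • (μ - s • ρ) with hσd
    have hσ : σ.PosSemidef := hp.smul (inv_pos.2 h1s).le
    have hmix : μ = s • ρ + (1 - s) • σ := by
      rw [hσd, smul_smul, mul_inv_cancel₀ h1s.ne', one_smul]; module
    have tσ : σ.trace = 1 := by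
      have : (1 - (s : ℂ)) ≠ 0 := by exact_mod_cast h1s.ne'
      rw [hσd, trace_smul, trace_sub, trace_smul, tρ, tμ]
      simp only [Complex.real_smul, mul_one]
      push_cast
      exact inv_mul_cancel₀ this
    have i1 := hK s σ hs hs1 hσ tσ hmix
    have hBC : ptrFst μ = s • ptrFst ρ + (1 - s) • ptrFst σ := by
      conv_lhs => rw [hmix]
      exact ptrFst_lin _ _ _ _
    have hAB : ptrC3 μ = s • ptrC3 ρ + (1 - s) • ptrC3 σ := by
      conv_lhs => rw [hmix]
      exact ptrC3_lin _ _ _ _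
    have i2 := conv_nonneg (ptrFst_psd hρ) (ptrFst_psd hσ) (ptrFst_psd hμ) hs hs1 hBC
      (by rw [ptrFst_trace, tρ]) (by rw [ptrFst_trace, tσ]) (by rw [ptrFst_trace, tμ])
    have i3 := conv_mono (ptrC3_psd hρ) (ptrC3_psd hσ) (ptrC3_psd hμ) hs hs1 hAB
    rw [ptr_B, ptr_B, ptr_B] at i3
    have i4 := mul_nonneg h1s.le (ssa hσ)
    have i5 := cmi_eta μ
    rw [hc, zero_mul] at i5
    rw [cmi_eta]
    refine le_of_mul_le_mul_left ?_ hs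
    have e : (1 - s) * ((s / (1 - s)) ^ 2 * K) = s * (s / (1 - s) * K) := by field_simp
    rw [e] at i1
    linarith
  have lim : Tendsto (fun s : ℝ => D + s / (1 - s) * K) (𝓝[>] 0) (𝓝 D) := by
    have : ContinuousAt (fun s : ℝ => D + s / (1 - s) * K) 0 := by
      refine continuousAt_const.add (ContinuousAt.mul (ContinuousAt.div continuousAt_id
        (by fun_prop) (by norm_num)) continuousAt_const)
    have h2 := this.tendsto
    simp only [zero_div, zero_mul, add_zero] at h2
    exact h2.mono_left nhdsWithin_le_nhds
  refine ge_of_tendsto lim ?_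
  filter_upwards [Ioo_mem_nhdsGT (lt_min one_pos hs0)] with s hs
  exact step s hs.1 (hs.2.trans_le (min_le_left _ _)) (hs.2.le.trans (min_le_right _ _))

theorem main_ereal {ρ μ : Matrix (A × B × C) (A × B × C) ℂ} (hρ : ρ.PosSemidef)
    (tρ : ρ.trace = 1) (hμ : μ.PosSemidef) (tμ : μ.trace = 1) (hc : cmi μ = 0) :
    ((cmi ρ : ℝ) : EReal) ≤ relEnt ρ μ := by
  rw [relEnt]
  split_ifs with h
  · exact EReal.coe_le_coe_iff.2 (main_real hρ tρ hμ tμ hc h)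
  · exact le_top

end QITaux

open QIT in
/-- the conditional mutual information is bounded above by the
relative entropy distance to any Markov chain, and hence by the infimum over
all Markov chains. -/
theorem cmi_le_relEnt_markov {A B C : Type*} [Fintype A] [Fintype B] [Fintype C]
    [DecidableEq A] [DecidableEq B] [DecidableEq C]
    (ρ : Matrix (A × B × C) (A × B × C) ℂ) (hρ : ρ.PosSemidef) (hρ1 : ρ.trace = 1) :
    (∀ μ : Matrix (A × B × C) (A × B × C) ℂ,
        μ.PosSemidef → μ.trace = 1 → cmi μ = 0 → ((cmi ρ : ℝ) : EReal) ≤ relEnt ρ μ) ∧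
      ((cmi ρ : ℝ) : EReal) ≤
        ⨅ μ ∈ {μ : Matrix (A × B × C) (A × B × C) ℂ |
            μ.PosSemidef ∧ μ.trace = 1 ∧ cmi μ = 0}, relEnt ρ μ := by
  refine ⟨fun μ h1 h2 h3 => QITaux.main_ereal hρ hρ1 h1 h2 h3, ?_⟩
  exact le_iInf₂ fun μ h => QITaux.main_ereal hρ hρ1 h.1 h.2.1 h.2.2
end
end
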